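/- Let I = (c,d) ⊂ ℝ, p ∈ (1,∞), p' = p/(p−1), w : I → (0,∞) measurable with ∫_x^d w^p < ∞ for all x ∈ I, and g measurable on I. Then sup over nonzero f ∈ Ch_{p,w}(I) of |∫_I f g| / ‖f‖_{Ch_{p,w}(I)} < ∞ if and only if g has a representative g̃ that is locally absolutely continuous, essentially bounded on I, and of the form g̃(x) = −χ_{(c,b]}(x) ∫_x^d Dg̃ for some b ∈ I, with Dg̃/w ∈ L^{p'}(I). In this case the supremum equals (∫_I |Dg̃/w|^{p'})^{1/p'}. -/

import Mathlib

open MeasureTheory Set Filter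

/-- membership in the altered Cesàro space `Ch_{p,w}((c,d))` (case ν = 1) -/
def memCh (c d p : ℝ) (w f : ℝ → ℝ) : Prop :=
  Measurable f ∧ (∀ x ∈ Ioo c d, IntegrableOn f (Ioc c x)) ∧
    IntegrableOn (fun x => |w x * ∫ t in Ioc c x, f t| ^ p) (Ioo c d)

/-- seminorm of the altered Cesàro space -/
noncomputable def chNorm (c d p : ℝ) (w f : ℝ → ℝ) : ℝ :=
  (∫ x in Ioo c d, |w x * ∫ t in Ioc c x, f t| ^ p) ^ (1/p)

/-- `g` has a representative `gt`, locally absolutely continuous with derivative `v`,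
bounded on `(c,d)`, of the form `gt x = -χ_{(c,b]}(x) ∫_x^d v`, with `v/w ∈ L^{p'}`. -/
def goodRepCh (c d q : ℝ) (w g gt v : ℝ → ℝ) (b : ℝ) : Prop :=
  b ∈ Ioo c d ∧ Measurable v ∧
    (∀ᵐ x ∂(volume.restrict (Ioo c d)), g x = gt x) ∧
    (∀ x ∈ Ioo c d, ∀ y ∈ Ioo c d,
      IntegrableOn v (uIcc x y) ∧ gt y - gt x = ∫ t in x..y, v t) ∧
    (∃ M : ℝ, ∀ x ∈ Ioo c d, |gt x| ≤ M) ∧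
    (∀ x ∈ Ioo c d, IntegrableOn v (Ioo x d)) ∧
    (∀ x ∈ Ioo c d,
      gt x = -(Ioc c b).indicator (fun y => ∫ t in Ioo y d, v t) x) ∧
    IntegrableOn (fun x => |v x / w x| ^ q) (Ioo c d)

open scoped NNReal

theorem tendsto_measure_symmDiff_biUnion_finset {α : Type*} [MeasurableSpace α] (μ : Measure α)
    [IsFiniteMeasure μ] {f : ℕ → Set α} (hf : ∀ i, MeasurableSet (f i))
    (hd : Pairwise (Function.onFun Disjoint f)) :
    Tendsto (fun s : Finset ℕ => μ (symmDiff (⋃ i ∈ s, f i) (⋃ i, f i))) atTop (nhds 0) := by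
  have hsum : ∑' i, μ (f i) ≠ ⊤ := by
    rw [← measure_iUnion hd hf]
    exact measure_ne_top _ _
  refine tendsto_of_tendsto_of_tendsto_of_le_of_le tendsto_const_nhds
    (ENNReal.tendsto_tsum_compl_atTop_zero hsum) (fun _ => zero_le) (fun s => ?_)
  refine le_trans (measure_mono ?_) (measure_iUnion_le (fun b : {x // x ∉ s} => f b))
  intro x hx
  rcases hx with ⟨h1, h2⟩ | ⟨h1, h2⟩
  · simp only [mem_iUnion] at h1 h2
    obtain ⟨i, -, hi⟩ := h1
    exact absurd ⟨i, hi⟩ h2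
  · simp only [mem_iUnion, not_exists] at h1 h2 ⊢
    obtain ⟨i, hi⟩ := h1
    exact ⟨⟨i, fun his => h2 i his hi⟩, hi⟩

theorem exists_integrable_forall_indicatorConstLp_eq {α : Type*} [MeasurableSpace α]
    (μ : Measure α) [IsFiniteMeasure μ] {P : ENNReal} [Fact (1 ≤ P)] (hP : P ≠ ⊤)
    (Λ : Lp ℝ P μ →L[ℝ] ℝ) :
    ∃ u : α → ℝ, Measurable u ∧ Integrable u μ ∧ ∀ (s : Set α) (hs : MeasurableSet s),
      Λ (indicatorConstLp P hs (measure_ne_top μ s) 1) = ∫ x in s, u x ∂μ := by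
  classical
  have hP0 : P ≠ 0 := (lt_of_lt_of_le one_pos (Fact.out : 1 ≤ P)).ne'
  have hzero : ∀ (s : Set α) (hs : MeasurableSet s), μ s = 0 →
      indicatorConstLp P hs (measure_ne_top μ s) (1 : ℝ) = 0 := by
    intro s hs h0
    rw [← norm_eq_zero, norm_indicatorConstLp hP0 hP]
    have : P.toReal ≠ 0 := ENNReal.toReal_ne_zero.2 ⟨hP0, hP⟩
    simp [Measure.real, h0, this]
  have hunion : ∀ (s t : Set α) (hs : MeasurableSet s) (ht : MeasurableSet t), Disjoint s t →
      indicatorConstLp P (hs.union ht) (measure_ne_top μ _) (1 : ℝ) =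
        indicatorConstLp P hs (measure_ne_top μ _) 1 +
        indicatorConstLp P ht (measure_ne_top μ _) 1 := fun s t hs ht hst =>
    indicatorConstLp_disjoint_union hs ht _ _ hst 1
  let ν : SignedMeasure α :=
    { measureOf' := fun s => if hs : MeasurableSet s then
        Λ (indicatorConstLp P hs (measure_ne_top μ s) 1) else 0
      empty' := by
        rw [dif_pos MeasurableSet.empty, hzero _ _ measure_empty, map_zero]
      not_measurable' := fun s hs => dif_neg hs
      m_iUnion' := by
        intro f hf hd
        have hfin : ∀ s : Finset ℕ, MeasurableSet (⋃ i ∈ s, f i) := fun s =>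
          s.measurableSet_biUnion fun i _ => hf i
        have key : ∀ s : Finset ℕ, Λ (indicatorConstLp P (hfin s) (measure_ne_top μ _) 1) =
            ∑ i ∈ s, Λ (indicatorConstLp P (hf i) (measure_ne_top μ _) 1) := by
          intro s
          induction s using Finset.induction_on with
          | empty =>
            rw [hzero _ _ (by simp)]
            simp
          | insert i s his ih =>
            rw [Finset.sum_insert his, ← ih, ← map_add, ← hunion]
            · congr 2
              simp
            · rw [Set.disjoint_iUnion₂_right]
              exact fun j hj => hd (fun h => his (h ▸ hj))
        have := (Λ.continuous.tendsto _).comp (tendsto_indicatorConstLp_set (p := P) (μ := μ)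
          (hs := MeasurableSet.iUnion hf) (hμs := measure_ne_top μ _) (c := (1 : ℝ))
          (ht := hfin) (hμt := fun _ => measure_ne_top μ _) hP
          (tendsto_measure_symmDiff_biUnion_finset μ hf hd))
        simp only [dif_pos (hf _), dif_pos (MeasurableSet.iUnion hf)]
        refine Tendsto.congr (fun s => ?_) this
        exact key s }
  have hν : ∀ (s : Set α) (hs : MeasurableSet s),
      ν s = Λ (indicatorConstLp P hs (measure_ne_top μ s) 1) := fun s hs => dif_pos hs
  have hac : ν ≪ᵥ μ.toENNRealVectorMeasure := by
    refine VectorMeasure.AbsolutelyContinuous.mk fun s hs h0 => ?_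
    rw [Measure.toENNRealVectorMeasure_apply_measurable hs] at h0
    rw [hν s hs, hzero s hs h0, map_zero]
  refine ⟨ν.rnDeriv μ, SignedMeasure.measurable_rnDeriv _ _, SignedMeasure.integrable_rnDeriv _ _,
    fun s hs => ?_⟩
  rw [← hν s hs, ← withDensityᵥ_apply (SignedMeasure.integrable_rnDeriv _ _) hs,
    SignedMeasure.withDensityᵥ_rnDeriv_eq _ _ hac]

theorem exists_forall_toLp_eq_integral_mul {α : Type*} [MeasurableSpace α]
    (μ : Measure α) [IsFiniteMeasure μ] {p q : ℝ} (hpq : p.HolderConjugate q)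
    [Fact (1 ≤ ENNReal.ofReal p)] (Λ : Lp ℝ (ENNReal.ofReal p) μ →L[ℝ] ℝ) :
    ∃ u : α → ℝ, Measurable u ∧ ∫⁻ x, ENNReal.ofReal (|u x| ^ q) ∂μ ≤ ENNReal.ofReal (‖Λ‖ ^ q) ∧
      MemLp u (ENNReal.ofReal q) μ ∧
      ∀ (f : α → ℝ) (hf : MemLp f (ENNReal.ofReal p) μ), Λ (hf.toLp f) = ∫ x, f x * u x ∂μ := by
  have hp0 : 0 < p := hpq.pos
  have hq0 : 0 < q := hpq.symm.pos
  have hpr : (ENNReal.ofReal p).toReal = p := ENNReal.toReal_ofReal hp0.le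
  have hqr : (ENNReal.ofReal q).toReal = q := ENNReal.toReal_ofReal hq0.le
  have hP0 : ENNReal.ofReal p ≠ 0 := by simpa using hp0
  have hQ0 : ENNReal.ofReal q ≠ 0 := by simpa using hq0
  obtain ⟨u, hum, hui, hu⟩ :=
    exists_integrable_forall_indicatorConstLp_eq μ (P := ENNReal.ofReal p) ENNReal.ofReal_ne_top Λ
  have hsm : ∀ φ : SimpleFunc α ℝ, MemLp φ (ENNReal.ofReal p) μ := fun φ =>
    φ.memLp_of_isFiniteMeasure _ _
  have hφi : ∀ φ : SimpleFunc α ℝ, Integrable (fun x => φ x * u x) μ := by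
    intro φ
    obtain ⟨C, hC⟩ := φ.exists_forall_norm_le
    exact hui.bdd_mul φ.aestronglyMeasurable (ae_of_all _ hC)
  have hsimple : ∀ φ : SimpleFunc α ℝ, Λ ((hsm φ).toLp φ) = ∫ x, φ x * u x ∂μ := by
    intro φ
    induction φ using SimpleFunc.induction with
    | const c hs =>
      rename_i s
      have h1 : (hsm (SimpleFunc.piecewise s hs (SimpleFunc.const α c)
          (SimpleFunc.const α 0))).toLp _ =
          c • indicatorConstLp (ENNReal.ofReal p) hs (measure_ne_top μ s) (1 : ℝ) := by
        rw [indicatorConstLp, ← MemLp.toLp_const_smul, MemLp.toLp_eq_toLp_iff]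
        refine ae_of_all _ fun x => ?_
        by_cases hx : x ∈ s <;> simp [hx]
      rw [h1, map_smul, hu s hs, smul_eq_mul, ← integral_const_mul, ← integral_indicator hs]
      congr 1
      ext x
      by_cases hx : x ∈ s <;> simp [hx]
    | add hd hf hg =>
      rename_i f g
      have h1 : (hsm (f + g)).toLp _ = (hsm f).toLp _ + (hsm g).toLp _ := by
        rw [← MemLp.toLp_add, MemLp.toLp_eq_toLp_iff]
        exact ae_of_all _ fun x => by simp
      rw [h1, map_add, hf, hg, ← integral_add (hφi f) (hφi g)]
      congr 1
      ext x
      simp [add_mul]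
  have hbound : ∫⁻ x, ENNReal.ofReal (|u x| ^ q) ∂μ ≤ ENNReal.ofReal (‖Λ‖ ^ q) := by
    rw [lintegral_eq_nnreal]
    refine iSup₂_le fun φ hφ => ?_
    have hφ' : ∀ x, (φ x : ℝ) ≤ |u x| ^ q := by
      intro x
      have := hφ x
      rw [← ENNReal.ofReal_coe_nnreal] at this
      exact (ENNReal.ofReal_le_ofReal_iff (by positivity)).1 this
    let σ : SimpleFunc α ℝ := SimpleFunc.piecewise {x | 0 ≤ u x} (measurableSet_le measurable_const hum)
      (SimpleFunc.const α 1) (SimpleFunc.const α (-1))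
    let s : SimpleFunc α ℝ := φ.map (fun t : ℝ≥0 => (t : ℝ) ^ p⁻¹)
    let ψ : SimpleFunc α ℝ := σ * s
    have hσ : ∀ x, σ x * u x = |u x| := by
      intro x
      by_cases hx : 0 ≤ u x
      · simp [σ, hx, abs_of_nonneg hx]
      · simp [σ, hx, abs_of_neg (not_le.1 hx)]
    have hσ1 : ∀ x, |σ x| = 1 := by
      intro x
      by_cases hx : 0 ≤ u x <;> simp [σ, hx]
    have hs : ∀ x, s x = (φ x : ℝ) ^ p⁻¹ := fun x => rfl
    have hψ : ∀ x, ψ x = σ x * s x := fun x => rfl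
    have habs : ∀ x, |ψ x| ^ p = (φ x : ℝ) := by
      intro x
      rw [hψ, abs_mul, hσ1, one_mul, hs, abs_of_nonneg (by positivity),
        ← Real.rpow_mul (by positivity), inv_mul_cancel₀ hp0.ne', Real.rpow_one]
    have hle : ∀ x, (φ x : ℝ) ≤ ψ x * u x := by
      intro x
      have e : ψ x * u x = (φ x : ℝ) ^ p⁻¹ * |u x| := by
        rw [hψ, ← hσ x, hs]
        ring
      rw [e]
      have h1 : (φ x : ℝ) = (φ x : ℝ) ^ p⁻¹ * (φ x : ℝ) ^ q⁻¹ := by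
        rw [← Real.rpow_add' (by positivity) (by rw [hpq.inv_add_inv_eq_one]; norm_num),
          hpq.inv_add_inv_eq_one, Real.rpow_one]
      have h2 : (φ x : ℝ) ^ q⁻¹ ≤ |u x| := by
        have := Real.rpow_le_rpow (by positivity) (hφ' x) (inv_nonneg.2 hq0.le)
        rwa [← Real.rpow_mul (by positivity), mul_inv_cancel₀ hq0.ne', Real.rpow_one] at this
      calc (φ x : ℝ) = (φ x : ℝ) ^ p⁻¹ * (φ x : ℝ) ^ q⁻¹ := h1
        _ ≤ _ := by gcongr
    set I : ℝ := ∫ x, (φ x : ℝ) ∂μ with hI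
    have hI0 : 0 ≤ I := integral_nonneg fun x => by positivity
    have hφint : Integrable (fun x => (φ x : ℝ)) μ :=
      (φ.map (fun t : ℝ≥0 => (t : ℝ))).integrable_of_isFiniteMeasure
    have hnorm : ‖(hsm ψ).toLp ψ‖ = I ^ p⁻¹ := by
      rw [Lp.norm_toLp, (hsm ψ).eLpNorm_eq_integral_rpow_norm hP0 ENNReal.ofReal_ne_top, hpr,
        ENNReal.toReal_ofReal (by positivity)]
      simp only [Real.norm_eq_abs, habs, hI]
    have h3 : I ≤ ‖Λ‖ * I ^ p⁻¹ := by
      calc I ≤ ∫ x, ψ x * u x ∂μ := integral_mono hφint (hφi ψ) hle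
        _ = Λ ((hsm ψ).toLp ψ) := (hsimple ψ).symm
        _ ≤ ‖Λ ((hsm ψ).toLp ψ)‖ := Real.le_norm_self _
        _ ≤ ‖Λ‖ * I ^ p⁻¹ := by rw [← hnorm]; exact Λ.le_opNorm _
    have h4 : I ≤ ‖Λ‖ ^ q := by
      rcases hI0.eq_or_lt with h0 | hpos
      · rw [← h0]; positivity
      have hsplit : I = I ^ p⁻¹ * I ^ q⁻¹ := by
        rw [← Real.rpow_add hpos, hpq.inv_add_inv_eq_one, Real.rpow_one]
      have h5 : I ^ q⁻¹ ≤ ‖Λ‖ := by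
        have : 0 < I ^ p⁻¹ := by positivity
        nlinarith
      have := Real.rpow_le_rpow (by positivity) h5 hq0.le
      rwa [← Real.rpow_mul hI0, inv_mul_cancel₀ hq0.ne', Real.rpow_one] at this
    have h6 : (SimpleFunc.map ENNReal.ofNNReal φ).lintegral μ = ENNReal.ofReal I := by
      rw [← SimpleFunc.lintegral_eq_lintegral, hI,
        ofReal_integral_eq_lintegral_ofReal hφint (ae_of_all _ fun x => by positivity)]
      simp
    rw [h6]
    exact ENNReal.ofReal_le_ofReal h4
  have huq : MemLp u (ENNReal.ofReal q) μ := by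
    rw [← integrable_norm_rpow_iff hum.aestronglyMeasurable hQ0 ENNReal.ofReal_ne_top, hqr]
    refine ⟨(hum.norm.pow_const q).aestronglyMeasurable, ?_⟩
    rw [hasFiniteIntegral_iff_ofReal (ae_of_all _ fun x => by positivity)]
    exact hbound.trans_lt ENNReal.ofReal_lt_top
  refine ⟨u, hum, hbound, huq, ?_⟩
  have := hpq.ennrealOfReal
  have : Fact (1 ≤ ENNReal.ofReal q) := ⟨by simpa using hpq.symm.lt.le⟩
  let Ψ : Lp ℝ (ENNReal.ofReal p) μ →L[ℝ] ℝ :=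
    (ContinuousLinearMap.lpPairing μ (ENNReal.ofReal p) (ENNReal.ofReal q)
      (ContinuousLinearMap.mul ℝ ℝ)).flip (huq.toLp u)
  have hΨ : ∀ (f : α → ℝ) (hf : MemLp f (ENNReal.ofReal p) μ),
      Ψ (hf.toLp f) = ∫ x, f x * u x ∂μ := by
    intro f hf
    simp only [Ψ, ContinuousLinearMap.flip_apply, ContinuousLinearMap.lpPairing_eq_integral,
      ContinuousLinearMap.mul_apply']
    refine integral_congr_ae ?_
    filter_upwards [hf.coeFn_toLp, huq.coeFn_toLp] with x h1 h2
    rw [h1, h2]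
  intro f hf
  rw [← hΨ]
  refine Lp.induction ENNReal.ofReal_ne_top (motive := fun f => Λ f = Ψ f) ?_ ?_ ?_ _
  · intro c s hs hμs
    have : (↑(Lp.simpleFunc.indicatorConst (ENNReal.ofReal p) hs hμs.ne c) :
        Lp ℝ (ENNReal.ofReal p) μ) = (hsm (SimpleFunc.piecewise s hs (SimpleFunc.const α c)
          (SimpleFunc.const α 0))).toLp _ := rfl
    rw [this, hsimple, hΨ]
  · intro f g hf hg _ h1 h2
    rw [map_add, map_add, h1, h2]
  · exact isClosed_eq Λ.continuous Ψ.continuous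

theorem exists_continuousLinearMap_comp_eq {X E : Type*} [AddCommGroup X] [Module ℝ X]
    [NormedAddCommGroup E] [NormedSpace ℝ E] (T : X →ₗ[ℝ] E) (Φ : X →ₗ[ℝ] ℝ) {C : ℝ} (hC : 0 ≤ C)
    (h : ∀ x, |Φ x| ≤ C * ‖T x‖) :
    ∃ Λ : E →L[ℝ] ℝ, ‖Λ‖ ≤ C ∧ ∀ x, Λ (T x) = Φ x := by
  have hker : LinearMap.ker T ≤ LinearMap.ker Φ := by
    intro x hx
    rw [LinearMap.mem_ker] at hx ⊢
    have := h x
    rw [hx, norm_zero, mul_zero] at this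
    exact abs_nonpos_iff.1 this
  let ψ : LinearMap.range T →ₗ[ℝ] ℝ :=
    ((LinearMap.ker T).liftQ Φ hker).comp T.quotKerEquivRange.symm.toLinearMap
  have hψ : ∀ x, ψ ⟨T x, LinearMap.mem_range_self T x⟩ = Φ x := by
    intro x
    have : T.quotKerEquivRange.symm ⟨T x, LinearMap.mem_range_self T x⟩ =
        (LinearMap.ker T).mkQ x := by
      rw [LinearEquiv.symm_apply_eq]
      rfl
    simp [ψ, this]
  have hb : ∀ y, ‖ψ y‖ ≤ C * ‖y‖ := by
    rintro ⟨_, x, rfl⟩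
    rw [hψ]
    exact h x
  obtain ⟨Λ, h1, h2⟩ := exists_extension_norm_eq (LinearMap.range T) (ψ.mkContinuous C hb)
  refine ⟨Λ, h2 ▸ ψ.mkContinuous_norm_le hC hb, fun x => ?_⟩
  rw [h1 ⟨T x, LinearMap.mem_range_self T x⟩]
  exact hψ x

theorem measurable_setIntegral_Ioc {f : ℝ → ℝ} (hf : Measurable f) (c : ℝ) :
    Measurable fun x => ∫ t in Ioc c x, f t := by
  have h1 : ∀ x, ∫ t in Ioc c x, f t = ∫ t, {z : ℝ × ℝ | c < z.2 ∧ z.2 ≤ z.1}.indicator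
      (fun z => f z.2) (x, t) := by
    intro x
    rw [← integral_indicator measurableSet_Ioc]
    rfl
  simp only [h1]
  refine (StronglyMeasurable.integral_prod_right' (Measurable.stronglyMeasurable ?_)).measurable
  refine (hf.comp measurable_snd).indicator ?_
  exact (measurableSet_lt measurable_const measurable_snd).inter
    (measurableSet_le measurable_snd measurable_fst)

theorem integral_mul_setIntegral_Ioi_eq {μ : Measure ℝ} [SFinite μ] {f v : ℝ → ℝ}
    (hf : Integrable f μ) (hv : Integrable v μ) :
    ∫ t, f t * (∫ s in Ioi t, v s ∂μ) ∂μ = ∫ s, (∫ t in Iio s, f t ∂μ) * v s ∂μ := by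
  have hS : MeasurableSet {z : ℝ × ℝ | z.1 < z.2} := measurableSet_lt measurable_fst measurable_snd
  have h := integral_integral_swap (μ := μ) (ν := μ)
    (f := fun t s => {z : ℝ × ℝ | z.1 < z.2}.indicator (fun z => f z.1 * v z.2) (t, s))
    ((hf.mul_prod hv).indicator hS)
  have h1 : ∀ t, ∫ s, {z : ℝ × ℝ | z.1 < z.2}.indicator (fun z => f z.1 * v z.2) (t, s) ∂μ =
      f t * (∫ s in Ioi t, v s ∂μ) := by
    intro t
    rw [← integral_const_mul, ← integral_indicator measurableSet_Ioi]
    rfl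
  have h2 : ∀ s, ∫ t, {z : ℝ × ℝ | z.1 < z.2}.indicator (fun z => f z.1 * v z.2) (t, s) ∂μ =
      (∫ t in Iio s, f t ∂μ) * v s := by
    intro s
    rw [← integral_mul_const, ← integral_indicator measurableSet_Iio]
    rfl
  simpa only [h1, h2] using h

section

variable {c d p q : ℝ} {w f g : ℝ → ℝ}

theorem memLp_iff_integrableOn_abs_rpow {h : ℝ → ℝ} {s : Set ℝ} (hp : 0 < p) (hm : Measurable h) :
    MemLp h (ENNReal.ofReal p) (volume.restrict s) ↔ IntegrableOn (fun x => |h x| ^ p) s := by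
  rw [← integrable_norm_rpow_iff hm.aestronglyMeasurable (by simpa using hp)
    ENNReal.ofReal_ne_top, ENNReal.toReal_ofReal hp.le]
  rfl

theorem memLp_of_memCh (hp : 0 < p) (hwm : Measurable w) (hf : memCh c d p w f) :
    MemLp (fun x => w x * ∫ t in Ioc c x, f t) (ENNReal.ofReal p) (volume.restrict (Ioo c d)) :=
  (memLp_iff_integrableOn_abs_rpow hp (hwm.mul (measurable_setIntegral_Ioc hf.1 c))).2 hf.2.2

theorem norm_toLp_eq_chNorm (hp : 0 < p) (hwm : Measurable w) (hf : memCh c d p w f) :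
    ‖(memLp_of_memCh hp hwm hf).toLp _‖ = chNorm c d p w f := by
  rw [Lp.norm_toLp, (memLp_of_memCh hp hwm hf).eLpNorm_eq_integral_rpow_norm (by simpa using hp)
    ENNReal.ofReal_ne_top, ENNReal.toReal_ofReal hp.le, ENNReal.toReal_ofReal (by positivity),
    chNorm, one_div]
  rfl

theorem memCh_add (hp : 0 < p) (hwm : Measurable w) (hf : memCh c d p w f)
    (hg : memCh c d p w g) : memCh c d p w (f + g) := by
  have hm : Measurable (f + g) := hf.1.add hg.1
  refine ⟨hm, fun x hx => (hf.2.1 x hx).add (hg.2.1 x hx), ?_⟩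
  refine (memLp_iff_integrableOn_abs_rpow hp (hwm.mul (measurable_setIntegral_Ioc hm c))).1 ?_
  refine ((memLp_of_memCh hp hwm hf).add (memLp_of_memCh hp hwm hg)).ae_eq ?_
  filter_upwards [ae_restrict_mem measurableSet_Ioo] with x hx
  simp only [Pi.add_apply, Pi.mul_apply]
  rw [integral_add (hf.2.1 x hx) (hg.2.1 x hx), mul_add]

theorem memCh_smul (hp : 0 < p) (hwm : Measurable w) (a : ℝ) (hf : memCh c d p w f) :
    memCh c d p w (a • f) := by
  have hm : Measurable (a • f) := hf.1.const_smul a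
  refine ⟨hm, fun x hx => (hf.2.1 x hx).smul a, ?_⟩
  refine (memLp_iff_integrableOn_abs_rpow hp (hwm.mul (measurable_setIntegral_Ioc hm c))).1 ?_
  refine ((memLp_of_memCh hp hwm hf).const_smul a).ae_eq (ae_of_all _ fun x => ?_)
  simp only [Pi.smul_apply, Pi.mul_apply, smul_eq_mul]
  rw [integral_const_mul]
  ring

/-- The altered Cesàro space as a submodule of the space of all functions. -/
def chSubmodule (c d : ℝ) (hp : 0 < p) (hwm : Measurable w) : Submodule ℝ (ℝ → ℝ) where
  carrier := {f | memCh c d p w f}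
  add_mem' hf hg := memCh_add hp hwm hf hg
  zero_mem' := ⟨measurable_const, fun _ _ => integrableOn_zero, by
    simp [hp.ne']⟩
  smul_mem' a _ hf := memCh_smul hp hwm a hf

theorem memCh_indicator_one (hp : 0 < p) (hwm : Measurable w)
    (hwpos : ∀ x ∈ Ioo c d, 0 < w x) {x : ℝ}
    (hwint : IntegrableOn (fun t => w t ^ p) (Ioo x d)) {A : Set ℝ} (hA : MeasurableSet A)
    (hAx : A ⊆ Ioo x d) : memCh c d p w (A.indicator 1) := by
  have hm : Measurable (A.indicator (1 : ℝ → ℝ)) := measurable_one.indicator hA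
  have hi : ∀ y, IntegrableOn (A.indicator (1 : ℝ → ℝ)) (Ioc c y) := fun y =>
    (integrableOn_const (C := (1 : ℝ)) (by simp)).indicator hA
  refine ⟨hm, fun y _ => hi y, ?_⟩
  have hdom : Integrable (fun y => (d - c) ^ p * (Ioo x d).indicator (fun t => w t ^ p) y)
      (volume.restrict (Ioo c d)) :=
    (((integrable_indicator_iff measurableSet_Ioo).2 hwint).const_mul _).restrict
  refine hdom.mono' ((hwm.mul (measurable_setIntegral_Ioc hm c)).abs.pow_const
    p).aestronglyMeasurable ?_
  filter_upwards [ae_restrict_mem measurableSet_Ioo] with y hy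
  have hF0 : 0 ≤ ∫ t in Ioc c y, A.indicator (1 : ℝ → ℝ) t :=
    integral_nonneg fun t => indicator_nonneg (fun _ _ => zero_le_one) t
  have hFle : ∫ t in Ioc c y, A.indicator (1 : ℝ → ℝ) t ≤ d - c := by
    calc ∫ t in Ioc c y, A.indicator (1 : ℝ → ℝ) t ≤ ∫ t in Ioc c y, (1 : ℝ) :=
          integral_mono (hi y) (integrable_const 1)
            fun t => indicator_le_self' (fun _ _ => zero_le_one) t
      _ = y - c := by simp [hy.1.le]
      _ ≤ d - c := by linarith [hy.2]
  rw [Real.norm_of_nonneg (by positivity)]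
  by_cases hxy : y ∈ Ioo x d
  · rw [indicator_of_mem hxy, abs_of_nonneg (mul_nonneg (hwpos y hy).le hF0),
      Real.mul_rpow (hwpos y hy).le hF0, mul_comm]
    have := Real.rpow_nonneg (hwpos y hy).le p
    gcongr
  · have hyx : y ≤ x := by
      by_contra h
      exact hxy ⟨not_le.1 h, hy.2⟩
    have : ∫ t in Ioc c y, A.indicator (1 : ℝ → ℝ) t = 0 := by
      refine setIntegral_eq_zero_of_forall_eq_zero fun t ht => indicator_of_notMem (fun h => ?_) _
      exact absurd (hAx h).1 (not_lt.2 (ht.2.trans hyx))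
    rw [this]
    simp [hxy, hp.ne']

theorem memLp_weight_Ioo (hp : 0 < p) (hwm : Measurable w)
    (hwpos : ∀ x ∈ Ioo c d, 0 < w x) {x : ℝ} (hx : x ∈ Ioo c d)
    (hwint : IntegrableOn (fun t => w t ^ p) (Ioo x d)) :
    MemLp w (ENNReal.ofReal p) (volume.restrict (Ioo x d)) := by
  rw [memLp_iff_integrableOn_abs_rpow hp hwm]
  refine hwint.congr_fun (fun t ht => ?_) measurableSet_Ioo
  simp only [abs_of_pos (hwpos t ⟨hx.1.trans ht.1, ht.2⟩)]

theorem ae_restrict_Ioo_of_forall_Ioo {P : ℝ → Prop} (hcd : c < d)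
    (h : ∀ x ∈ Ioo c d, ∀ᵐ y ∂(volume.restrict (Ioo x d)), P y) :
    ∀ᵐ y ∂(volume.restrict (Ioo c d)), P y := by
  obtain ⟨a, -, ha, hlim⟩ := exists_seq_strictAnti_tendsto' hcd
  refine ae_restrict_of_ae_restrict_of_subset (t := ⋃ n, Ioo (a n) d) ?_
    ((ae_restrict_iUnion_iff _ _).2 fun n => h (a n) (ha n))
  intro y hy
  obtain ⟨n, hn⟩ := (hlim.eventually_lt_const hy.1).exists
  exact mem_iUnion.2 ⟨n, hn, hy.2⟩

theorem exists_density_of_bounded (hcd : c < d) (hpq : p.HolderConjugate q)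
    (hwm : Measurable w) (hwpos : ∀ x ∈ Ioo c d, 0 < w x)
    (hwint : ∀ x ∈ Ioo c d, IntegrableOn (fun t => w t ^ p) (Ioo x d))
    {C : ℝ} (hC : 0 ≤ C)
    (hi : ∀ f, memCh c d p w f → IntegrableOn (fun x => f x * g x) (Ioo c d))
    (hb : ∀ f, memCh c d p w f → |∫ x in Ioo c d, f x * g x| ≤ C * chNorm c d p w f) :
    ∃ v : ℝ → ℝ, Measurable v ∧ IntegrableOn (fun x => |v x / w x| ^ q) (Ioo c d) ∧
      (∫ x in Ioo c d, |v x / w x| ^ q) ^ (1 / q) ≤ C ∧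
      (∀ x ∈ Ioo c d, IntegrableOn v (Ioo x d)) ∧
      ∀ᵐ x ∂(volume.restrict (Ioo c d)), g x = -∫ t in Ioo x d, v t := by
  have hp0 : 0 < p := hpq.pos
  have hq0 : 0 < q := hpq.symm.pos
  have : Fact (1 ≤ ENNReal.ofReal p) := ⟨by simpa using hpq.lt.le⟩
  let T : chSubmodule c d hp0 hwm →ₗ[ℝ] Lp ℝ (ENNReal.ofReal p) (volume.restrict (Ioo c d)) :=
    { toFun := fun f => (memLp_of_memCh hp0 hwm f.2).toLp _
      map_add' := by
        intro f g
        rw [← MemLp.toLp_add, MemLp.toLp_eq_toLp_iff]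
        filter_upwards [ae_restrict_mem measurableSet_Ioo] with x hx
        simp only [Submodule.coe_add, Pi.add_apply]
        rw [integral_add (f.2.2.1 x hx) (g.2.2.1 x hx), mul_add]
      map_smul' := by
        intro a f
        rw [RingHom.id_apply, ← MemLp.toLp_const_smul, MemLp.toLp_eq_toLp_iff]
        refine ae_of_all _ fun x => ?_
        simp only [Submodule.coe_smul, Pi.smul_apply, smul_eq_mul]
        rw [integral_const_mul]
        ring }
  let Φ : chSubmodule c d hp0 hwm →ₗ[ℝ] ℝ :=
    { toFun := fun f => ∫ x in Ioo c d, f.1 x * g x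
      map_add' := by
        intro f₁ f₂
        rw [← integral_add (hi _ f₁.2) (hi _ f₂.2)]
        simp only [Submodule.coe_add, Pi.add_apply, add_mul]
      map_smul' := by
        intro a f
        simp only [Submodule.coe_smul, Pi.smul_apply, smul_eq_mul, RingHom.id_apply]
        rw [← integral_const_mul]
        simp only [mul_assoc] }
  obtain ⟨Λ, hΛC, hΛ⟩ := exists_continuousLinearMap_comp_eq T Φ hC fun f => by
    change |∫ x in Ioo c d, f.1 x * g x| ≤ C * ‖(memLp_of_memCh hp0 hwm f.2).toLp _‖
    rw [norm_toLp_eq_chNorm hp0 hwm f.2]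
    exact hb _ f.2
  obtain ⟨u, hum, hub, huq, hu⟩ := exists_forall_toLp_eq_integral_mul _ hpq Λ
  have hrep : ∀ f, memCh c d p w f → ∫ x in Ioo c d, f x * g x =
      ∫ x in Ioo c d, (w x * ∫ t in Ioc c x, f t) * u x := fun f hf => by
    rw [← hu _ (memLp_of_memCh hp0 hwm hf)]
    exact (hΛ ⟨f, hf⟩).symm
  have huw : ∀ x ∈ Ioo c d, |-(w x * u x) / w x| ^ q = |u x| ^ q := fun x hx => by
    rw [neg_div, abs_neg, mul_div_cancel_left₀ _ (hwpos x hx).ne']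
  have hwu : ∀ x ∈ Ioo c d, IntegrableOn (fun t => w t * u t) (Ioo x d) := fun x hx => by
    have hpqE := hpq.ennrealOfReal
    exact (memLp_weight_Ioo hp0 hwm hwpos hx (hwint x hx)).integrable_mul
      (huq.mono_measure (Measure.restrict_mono (Ioo_subset_Ioo_left hx.1.le) le_rfl))
  have hui : IntegrableOn (fun x => |u x| ^ q) (Ioo c d) :=
    (memLp_iff_integrableOn_abs_rpow hq0 hum).1 huq
  refine ⟨fun x => -(w x * u x), (hwm.mul hum).neg,
    hui.congr_fun (fun x hx => (huw x hx).symm) measurableSet_Ioo, ?_,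
    fun x hx => (hwu x hx).neg, ?_⟩
  · rw [setIntegral_congr_fun measurableSet_Ioo huw]
    have h1 : ∫ x in Ioo c d, |u x| ^ q ≤ C ^ q := by
      rw [← ofReal_integral_eq_lintegral_ofReal hui (ae_of_all _ fun x => by positivity),
        ENNReal.ofReal_le_ofReal_iff (by positivity)] at hub
      exact hub.trans (Real.rpow_le_rpow (norm_nonneg _) hΛC hq0.le)
    calc (∫ x in Ioo c d, |u x| ^ q) ^ (1 / q) ≤ (C ^ q) ^ (1 / q) :=
          Real.rpow_le_rpow (integral_nonneg fun x => by positivity) h1 (by positivity)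
      _ = C := by rw [← Real.rpow_mul hC, mul_one_div_cancel hq0.ne', Real.rpow_one]
  · refine ae_restrict_Ioo_of_forall_Ioo hcd fun x hx => ?_
    have hAmem := fun A hA hAx => memCh_indicator_one (A := A) hp0 hwm hwpos (hwint x hx) hA hAx
    have hmul : ∀ A : Set ℝ, (fun t => A.indicator (1 : ℝ → ℝ) t * g t) = A.indicator g := by
      intro A
      ext t
      by_cases ht : t ∈ A <;> simp [ht]
    have hsub : Ioo x d ⊆ Ioo c d := Ioo_subset_Ioo_left hx.1.le
    have hgi : Integrable g (volume.restrict (Ioo x d)) := by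
      have := hi _ (hAmem _ measurableSet_Ioo subset_rfl)
      rw [hmul, IntegrableOn, integrable_indicator_iff measurableSet_Ioo, IntegrableOn,
        Measure.restrict_restrict measurableSet_Ioo, inter_eq_left.2 hsub] at this
      exact this
    have hw1 := hwu x hx
    have hV : ∀ t ∈ Ioo x d, ∫ s in Ioo t d, w s * u s =
        ∫ s in Ioi t, w s * u s ∂(volume.restrict (Ioo x d)) := by
      intro t ht
      rw [Measure.restrict_restrict measurableSet_Ioi]
      congr 2
      ext s
      exact ⟨fun h => ⟨h.1, ht.1.trans h.1, h.2⟩, fun h => ⟨h.1, h.2.2⟩⟩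
    have hVi : Integrable (fun t => ∫ s in Ioi t, w s * u s ∂(volume.restrict (Ioo x d)))
        (volume.restrict (Ioo x d)) := by
      refine Integrable.of_bound (C := ∫ s, ‖w s * u s‖ ∂(volume.restrict (Ioo x d)))
        (Measurable.aestronglyMeasurable ?_) (ae_of_all _ fun t =>
          (norm_integral_le_integral_norm _).trans
          (setIntegral_le_integral hw1.norm (ae_of_all _ fun s => norm_nonneg _)))
      have h1 : ∀ t, ∫ s in Ioi t, w s * u s ∂(volume.restrict (Ioo x d)) =
          ∫ s, {z : ℝ × ℝ | z.1 < z.2}.indicator (fun z => w z.2 * u z.2) (t, s)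
            ∂(volume.restrict (Ioo x d)) := by
        intro t
        rw [← integral_indicator measurableSet_Ioi]
        rfl
      simp only [h1]
      refine (StronglyMeasurable.integral_prod_right' (Measurable.stronglyMeasurable ?_)).measurable
      exact ((hwm.mul hum).comp measurable_snd).indicator
        (measurableSet_lt measurable_fst measurable_snd)
    have hae : g =ᵐ[volume.restrict (Ioo x d)]
        fun t => ∫ s in Ioi t, w s * u s ∂(volume.restrict (Ioo x d)) := by
      refine hgi.ae_eq_of_forall_setIntegral_eq _ _ hVi fun A hA _ => ?_
      set B := A ∩ Ioo x d with hB
      have hBm : MeasurableSet B := hA.inter measurableSet_Ioo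
      have hBmem := hAmem B hBm inter_subset_right
      have hBi : Integrable (B.indicator (1 : ℝ → ℝ)) (volume.restrict (Ioo x d)) :=
        (integrable_const (1 : ℝ)).indicator hBm
      have h1 : ∫ t in A, g t ∂(volume.restrict (Ioo x d)) =
          ∫ t in Ioo c d, B.indicator (1 : ℝ → ℝ) t * g t := by
        rw [hmul, integral_indicator hBm, Measure.restrict_restrict hBm,
          Measure.restrict_restrict hA, inter_eq_left.2 (inter_subset_right.trans hsub)]
      have h2 : ∫ t in Ioo c d, (w t * ∫ s in Ioc c t, B.indicator (1 : ℝ → ℝ) s) * u t =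
          ∫ t in Ioo x d, (w t * ∫ s in Ioc c t, B.indicator (1 : ℝ → ℝ) s) * u t := by
        refine setIntegral_eq_of_subset_of_forall_sdiff_eq_zero measurableSet_Ioo hsub ?_
        rintro t ⟨ht, htx⟩
        have htx' : t ≤ x := by
          by_contra h
          exact htx ⟨not_le.1 h, ht.2⟩
        have : ∫ s in Ioc c t, B.indicator (1 : ℝ → ℝ) s = 0 :=
          setIntegral_eq_zero_of_forall_eq_zero fun s hs => indicator_of_notMem
            (fun h => absurd h.2.1 (not_lt.2 (hs.2.trans htx'))) _
        rw [this, mul_zero, zero_mul]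
      have h3 : ∀ t ∈ Ioo x d, (w t * ∫ s in Ioc c t, B.indicator (1 : ℝ → ℝ) s) * u t =
          (∫ s in Iio t, B.indicator (1 : ℝ → ℝ) s ∂(volume.restrict (Ioo x d))) *
            (w t * u t) := by
        intro t ht
        have : ∫ s in Ioc c t, B.indicator (1 : ℝ → ℝ) s =
            ∫ s in Iio t, B.indicator (1 : ℝ → ℝ) s ∂(volume.restrict (Ioo x d)) := by
          rw [integral_Ioc_eq_integral_Ioo, Measure.restrict_restrict measurableSet_Iio]
          refine setIntegral_eq_of_subset_of_forall_sdiff_eq_zero measurableSet_Ioo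
            (fun s hs => ⟨hx.1.trans hs.2.1, hs.1⟩) ?_
          rintro s ⟨hs, hsx⟩
          exact indicator_of_notMem (fun h => hsx ⟨hs.2, h.2⟩) _
        rw [this]
        ring
      rw [h1, hrep _ hBmem, h2, setIntegral_congr_fun measurableSet_Ioo h3,
        ← integral_mul_setIntegral_Ioi_eq hBi hw1, ← integral_indicator hA]
      refine setIntegral_congr_fun measurableSet_Ioo fun t ht => ?_
      by_cases htA : t ∈ A
      · simp [hB, htA, ht]
      · simp [hB, htA]
    filter_upwards [hae, ae_restrict_mem measurableSet_Ioo] with t ht htm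
    rw [ht, ← hV t htm, integral_neg, neg_neg]

theorem setIntegral_mul_setIntegral_Ioc_eq {f v : ℝ → ℝ} {x y : ℝ}
    (hf : IntegrableOn f (Ioc x y)) (hv : IntegrableOn v (Ioc x y)) :
    ∫ t in Ioc x y, f t * (∫ s in Ioc t y, v s) =
      ∫ s in Ioc x y, (∫ t in Ioc x s, f t) * v s := by
  have h1 : ∀ t ∈ Ioc x y, f t * (∫ s in Ioc t y, v s) =
      f t * (∫ s in Ioi t, v s ∂(volume.restrict (Ioc x y))) := by
    intro t ht
    rw [Measure.restrict_restrict measurableSet_Ioi]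
    congr 3
    ext s
    exact ⟨fun h => ⟨h.1, ht.1.trans h.1, h.2⟩, fun h => ⟨h.1, h.2.2⟩⟩
  have h2 : ∀ s ∈ Ioc x y, (∫ t in Ioc x s, f t) * v s =
      (∫ t in Iio s, f t ∂(volume.restrict (Ioc x y))) * v s := by
    intro s hs
    rw [Measure.restrict_restrict measurableSet_Iio, integral_Ioc_eq_integral_Ioo]
    congr 3
    ext t
    exact ⟨fun h => ⟨h.2, h.1, h.2.le.trans hs.2⟩, fun h => ⟨h.2.1, h.1⟩⟩
  rw [setIntegral_congr_fun measurableSet_Ioc h1, setIntegral_congr_fun measurableSet_Ioc h2]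
  exact integral_mul_setIntegral_Ioi_eq hf hv

theorem tendsto_setIntegral_Ioc_nhdsGT {f : ℝ → ℝ} {c x : ℝ} (hx : c < x)
    (hf : IntegrableOn f (Ioc c x)) :
    Tendsto (fun y => ∫ t in Ioc c y, f t) (nhdsWithin c (Ioi c)) (nhds 0) := by
  have h := intervalIntegral.continuousOn_primitive
    ((integrableOn_Icc_iff_integrableOn_Ioc).2 hf) c (left_mem_Icc.2 hx.le)
  have h' : Tendsto (fun y => ∫ t in Ioc c y, f t) (nhdsWithin c (Icc c x)) (nhds 0) := by
    simpa [ContinuousWithinAt] using h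
  refine h'.mono_left ?_
  rw [← nhdsWithin_Ioc_eq_nhdsGT hx]
  exact nhdsWithin_mono _ Ioc_subset_Icc_self

theorem integrableOn_mul_of_goodRepCh {gt v : ℝ → ℝ} {b : ℝ} (hgm : Measurable g)
    (hG : goodRepCh c d q w g gt v b) (hf : memCh c d p w f) :
    IntegrableOn (fun x => f x * g x) (Ioo c d) := by
  obtain ⟨hb, -, hg, -, ⟨M, hM⟩, -, hrep, -⟩ := hG
  have h1 : Integrable (fun x => (Ioc c b).indicator f x * g x) (volume.restrict (Ioo c d)) := by
    refine Integrable.mul_bdd (c := M)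
      (((integrable_indicator_iff measurableSet_Ioc).2 (hf.2.1 b hb)).restrict)
      hgm.aestronglyMeasurable ?_
    filter_upwards [hg, ae_restrict_mem measurableSet_Ioo] with x hx hxm
    rw [hx]
    exact hM x hxm
  refine h1.congr ?_
  filter_upwards [hg, ae_restrict_mem measurableSet_Ioo] with x hx hxm
  by_cases hxb : x ∈ Ioc c b
  · simp [hxb]
  · simp [hx, hrep x hxm, hxb]

theorem memLp_div_of_goodRepCh {gt v : ℝ → ℝ} {b : ℝ} (hq : 0 < q) (hwm : Measurable w)
    (hG : goodRepCh c d q w g gt v b) :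
    MemLp (fun x => v x / w x) (ENNReal.ofReal q) (volume.restrict (Ioo c d)) :=
  (memLp_iff_integrableOn_abs_rpow hq (hG.2.1.div hwm)).2 hG.2.2.2.2.2.2.2

theorem setIntegral_mul_add_eq_of_goodRepCh {gt v : ℝ → ℝ} {b : ℝ}
    (hG : goodRepCh c d q w g gt v b) (hf : memCh c d p w f)
    {x y : ℝ} (hx : x ∈ Ioo c d) (hy : y ∈ Ioo c d) (hxy : x ≤ y)
    (hfg : IntegrableOn (fun t => f t * g t) (Ioo c d))
    (hFv : IntegrableOn (fun t => (∫ s in Ioc c t, f s) * v t) (Ioo c d)) :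
    ∫ t in Ioc x y, (f t * g t + (∫ s in Ioc c t, f s) * v t) =
      gt y * (∫ s in Ioc c y, f s) - gt x * (∫ s in Ioc c x, f s) := by
  obtain ⟨-, -, hg, hgv, -, -, -, -⟩ := hG
  have hsub : Ioc x y ⊆ Ioo c d := fun t ht => ⟨hx.1.trans ht.1, ht.2.trans_lt hy.2⟩
  have hfi : IntegrableOn f (Ioc x y) := (hf.2.1 y hy).mono_set (Ioc_subset_Ioc_left hx.1.le)
  have hvi : IntegrableOn v (Ioc x y) := by
    refine (hgv x hx y hy).1.mono_set ?_
    rw [uIcc_of_le hxy]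
    exact Ioc_subset_Icc_self
  have hFsub : ∀ t ∈ Ioc x y, ∫ s in Ioc x t, f s =
      (∫ s in Ioc c t, f s) - ∫ s in Ioc c x, f s := by
    intro t ht
    have htI := hsub ht
    rw [← Ioc_union_Ioc_eq_Ioc hx.1.le ht.1.le, setIntegral_union
      (Ioc_disjoint_Ioc_of_le le_rfl) measurableSet_Ioc (hf.2.1 x hx)
      ((hf.2.1 t htI).mono_set (Ioc_subset_Ioc_left hx.1.le))]
    ring
  have hvsub : ∀ t ∈ Ioc x y, ∫ s in Ioc t y, v s = gt y - gt t := by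
    intro t ht
    rw [(hgv t (hsub ht) y hy).2, intervalIntegral.integral_of_le ht.2]
  have hvxy : ∫ s in Ioc x y, v s = gt y - gt x := by
    rw [(hgv x hx y hy).2, intervalIntegral.integral_of_le hxy]
  have hfg' := hfg.mono_set hsub
  have hFv' := hFv.mono_set hsub
  have hibp := setIntegral_mul_setIntegral_Ioc_eq hfi hvi
  have e1 : ∫ t in Ioc x y, f t * (∫ s in Ioc t y, v s) =
      gt y * (∫ t in Ioc x y, f t) - ∫ t in Ioc x y, f t * g t := by
    rw [← integral_const_mul, ← integral_sub (hfi.const_mul _) hfg']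
    refine integral_congr_ae ?_
    filter_upwards [ae_restrict_mem measurableSet_Ioc,
      ae_restrict_of_ae_restrict_of_subset hsub hg] with t ht hgt
    rw [hvsub t ht, hgt]
    ring
  have e2 : ∫ s in Ioc x y, (∫ t in Ioc x s, f t) * v s =
      (∫ s in Ioc x y, (∫ t in Ioc c s, f t) * v s) -
        (∫ s in Ioc c x, f s) * ∫ s in Ioc x y, v s := by
    rw [← integral_const_mul, ← integral_sub hFv' (hvi.const_mul _)]
    refine setIntegral_congr_fun measurableSet_Ioc fun s hs => ?_
    simp only [hFsub s hs]
    ring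
  rcases hxy.eq_or_lt with rfl | hlt
  · simp
  rw [integral_add hfg' hFv']
  rw [e1, e2, hvxy, hFsub y (right_mem_Ioc.2 hlt)] at hibp
  linarith

theorem integral_mul_eq_neg_of_goodRepCh {gt v : ℝ → ℝ} {b : ℝ}
    (hG : goodRepCh c d q w g gt v b) (hf : memCh c d p w f)
    (hfg : IntegrableOn (fun t => f t * g t) (Ioo c d))
    (hFv : IntegrableOn (fun t => (∫ s in Ioc c t, f s) * v t) (Ioo c d)) :
    ∫ t in Ioo c d, f t * g t = -∫ t in Ioo c d, (∫ s in Ioc c t, f s) * v t := by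
  have hb := hG.1
  have hcd : c < d := hb.1.trans hb.2
  obtain ⟨M, hM⟩ := hG.2.2.2.2.1
  have hrep := hG.2.2.2.2.2.2.1
  obtain ⟨x, -, hx, hxlim⟩ := exists_seq_strictAnti_tendsto' hb.1
  obtain ⟨y, -, hy, hylim⟩ := exists_seq_strictMono_tendsto' hb.2
  have hxI : ∀ n, x n ∈ Ioo c d := fun n => ⟨(hx n).1, (hx n).2.trans hb.2⟩
  have hyI : ∀ n, y n ∈ Ioo c d := fun n => ⟨hb.1.trans (hy n).1, (hy n).2⟩
  have hlim := (aecover_Ioo_of_Ioc hxlim hylim).integral_tendsto_of_countably_generated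
    (hfg.add hFv)
  have hval : ∀ n, ∫ t in Ioc (x n) (y n), (f t * g t + (∫ s in Ioc c t, f s) * v t)
      ∂(volume.restrict (Ioo c d)) = -(gt (x n) * ∫ s in Ioc c (x n), f s) := by
    intro n
    have hsub : Ioc (x n) (y n) ⊆ Ioo c d := fun t ht =>
      ⟨(hxI n).1.trans ht.1, ht.2.trans_lt (hyI n).2⟩
    have hgy : gt (y n) = 0 := by
      rw [hrep _ (hyI n), indicator_of_notMem (fun h => absurd h.2 (not_le.2 (hy n).1)), neg_zero]
    rw [Measure.restrict_restrict measurableSet_Ioc, inter_eq_left.2 hsub,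
      setIntegral_mul_add_eq_of_goodRepCh hG hf (hxI n) (hyI n)
        ((hx n).2.trans (hy n).1).le hfg hFv, hgy]
    ring
  have hzero : Tendsto (fun n => -(gt (x n) * ∫ s in Ioc c (x n), f s)) atTop (nhds 0) := by
    have hF : Tendsto (fun n => ∫ s in Ioc c (x n), f s) atTop (nhds 0) :=
      (tendsto_setIntegral_Ioc_nhdsGT hb.1 (hf.2.1 b hb)).comp
        (tendsto_nhdsWithin_iff.2 ⟨hxlim, Eventually.of_forall fun n => (hx n).1⟩)
    rw [← neg_zero]
    refine Tendsto.neg (squeeze_zero_norm (a := fun n => M * |∫ s in Ioc c (x n), f s|)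
      (fun n => ?_) (by simpa using hF.abs.const_mul M))
    rw [norm_mul]
    exact mul_le_mul_of_nonneg_right (hM _ (hxI n)) (abs_nonneg _)
  have huniq := tendsto_nhds_unique hlim (hzero.congr fun n => (hval n).symm)
  have hadd := integral_add (μ := volume.restrict (Ioo c d)) hfg hFv
  simp only [Pi.add_apply] at huniq
  linarith

theorem abs_integral_mul_le_of_goodRepCh {gt v : ℝ → ℝ} {b : ℝ} (hpq : p.HolderConjugate q)
    (hwm : Measurable w) (hwpos : ∀ x ∈ Ioo c d, 0 < w x) (hgm : Measurable g)
    (hG : goodRepCh c d q w g gt v b) (hf : memCh c d p w f) :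
    |∫ x in Ioo c d, f x * g x| ≤
      (∫ x in Ioo c d, |v x / w x| ^ q) ^ (1 / q) * chNorm c d p w f := by
  have hpqE := hpq.ennrealOfReal
  have h1 := memLp_of_memCh hpq.pos hwm hf
  have h2 := memLp_div_of_goodRepCh hpq.symm.pos hwm hG
  have heq : ∀ x ∈ Ioo c d, (w x * ∫ t in Ioc c x, f t) * (v x / w x) =
      (∫ t in Ioc c x, f t) * v x := by
    intro x hx
    have := (hwpos x hx).ne'
    field_simp
  have hFv : IntegrableOn (fun t => (∫ s in Ioc c t, f s) * v t) (Ioo c d) :=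
    IntegrableOn.congr_fun (h1.integrable_mul h2) heq measurableSet_Ioo
  rw [integral_mul_eq_neg_of_goodRepCh hG hf (integrableOn_mul_of_goodRepCh hgm hG hf) hFv,
    abs_neg, ← setIntegral_congr_fun measurableSet_Ioo heq]
  calc |∫ x in Ioo c d, (w x * ∫ t in Ioc c x, f t) * (v x / w x)|
      ≤ ∫ x in Ioo c d, ‖w x * ∫ t in Ioc c x, f t‖ * ‖v x / w x‖ := by
        refine abs_integral_le_integral_abs.trans (le_of_eq ?_)
        simp only [abs_mul, Real.norm_eq_abs]
    _ ≤ _ := integral_mul_norm_le_Lp_mul_Lq hpq h1 h2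
    _ = _ := by
        rw [mul_comm]
        rfl

end

/-- The derivative of a tent of width `2 * η` centred at `t` and of slope `h`. -/
noncomputable def zigzag (t η h : ℝ) (x : ℝ) : ℝ :=
  (Ioc (t - η) t).indicator (fun _ => h) x - (Ioc t (t + η)).indicator (fun _ => h) x

section

variable {t η h : ℝ}

theorem measurable_zigzag : Measurable (zigzag t η h) :=
  (measurable_const.indicator measurableSet_Ioc).sub (measurable_const.indicator measurableSet_Ioc)

theorem zigzag_of_notMem (hη : 0 ≤ η) {x : ℝ} (hx : x ∉ Ioc (t - η) (t + η)) :
    zigzag t η h x = 0 := by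
  rw [zigzag, indicator_of_notMem, indicator_of_notMem, sub_zero]
  · exact fun h => hx ⟨by linarith [h.1], h.2⟩
  · exact fun h => hx ⟨h.1, by linarith [h.2]⟩

theorem abs_zigzag_of_mem {x : ℝ} (hx : x ∈ Ioc (t - η) (t + η)) : |zigzag t η h x| = |h| := by
  rcases le_or_gt x t with hxt | hxt
  · rw [zigzag, indicator_of_mem (show x ∈ Ioc (t - η) t from ⟨hx.1, hxt⟩),
      indicator_of_notMem (fun h => absurd h.1 hxt.not_gt), sub_zero]
  · rw [zigzag, indicator_of_notMem (fun h => absurd h.2 hxt.not_ge),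
      indicator_of_mem (show x ∈ Ioc t (t + η) from ⟨hxt, hx.2⟩), zero_sub, abs_neg]

theorem abs_zigzag (hη : 0 ≤ η) (x : ℝ) :
    |zigzag t η h x| = (Ioc (t - η) (t + η)).indicator (fun _ => |h|) x := by
  by_cases hx : x ∈ Ioc (t - η) (t + η)
  · rw [abs_zigzag_of_mem hx, indicator_of_mem hx]
  · rw [zigzag_of_notMem hη hx, indicator_of_notMem hx, abs_zero]

theorem integrable_zigzag : Integrable (zigzag t η h) :=
  ((integrable_indicator_iff measurableSet_Ioc).2 (integrableOn_const (by simp))).sub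
    ((integrable_indicator_iff measurableSet_Ioc).2 (integrableOn_const (by simp)))

theorem setIntegral_abs_zigzag_le (hη : 0 ≤ η) (hh : 0 ≤ h) (s : Set ℝ) :
    ∫ x in s, |zigzag t η h x| ≤ h * (2 * η) := by
  refine (setIntegral_le_integral integrable_zigzag.abs (ae_of_all _ fun x => abs_nonneg _)).trans
    (le_of_eq ?_)
  simp only [abs_zigzag hη]
  rw [integral_indicator measurableSet_Ioc, setIntegral_const, abs_of_nonneg hh, smul_eq_mul,
    Real.volume_real_Ioc_of_le (by linarith)]
  ring

theorem abs_setIntegral_zigzag_le (hη : 0 ≤ η) (hh : 0 ≤ h) (s : Set ℝ) :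
    |∫ x in s, zigzag t η h x| ≤ h * (2 * η) :=
  abs_integral_le_integral_abs.trans (setIntegral_abs_zigzag_le hη hh s)

theorem setIntegral_zigzag_eq_zero (hη : 0 ≤ η) {c x : ℝ} (hc : c ≤ t - η)
    (hx : x ∉ Ioc (t - η) (t + η)) : ∫ s in Ioc c x, zigzag t η h s = 0 := by
  rcases le_or_gt x (t - η) with hxt | hxt
  · exact setIntegral_eq_zero_of_forall_eq_zero fun s hs =>
      zigzag_of_notMem hη fun h => absurd h.1 (hs.2.trans hxt).not_gt
  · have hx2 : t + η < x := by
      by_contra h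
      exact hx ⟨hxt, not_lt.1 h⟩
    simp only [zigzag]
    rw [integral_sub ((integrable_indicator_iff measurableSet_Ioc).2
        (integrableOn_const (by simp))).restrict ((integrable_indicator_iff measurableSet_Ioc).2
        (integrableOn_const (by simp))).restrict, setIntegral_indicator measurableSet_Ioc,
      setIntegral_indicator measurableSet_Ioc,
      inter_eq_right.2 (Ioc_subset_Ioc hc (by linarith)),
      inter_eq_right.2 (Ioc_subset_Ioc (by linarith) hx2.le), setIntegral_const, setIntegral_const,
      Real.volume_real_Ioc_of_le (by linarith), Real.volume_real_Ioc_of_le (by linarith)]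
    simp

end

theorem exists_Icc_subset_setLIntegral_le {U : Set ℝ} (hU : IsOpen U) {t : ℝ} (ht : t ∈ U)
    {ρ : ℝ → ENNReal} (hρ : ∫⁻ x in U, ρ x ≠ ⊤) {ε : ENNReal} (hε : ε ≠ 0) :
    ∃ η > 0, Icc (t - η) (t + η) ⊆ U ∧ ∫⁻ x in Icc (t - η) (t + η), ρ x ≤ ε := by
  set μ := (volume.restrict U).withDensity ρ with hμ
  have : IsFiniteMeasure μ := isFiniteMeasure_withDensity hρ
  have h0 : μ {t} = 0 := by
    exact withDensity_absolutelyContinuous _ _ (measure_singleton t)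
  obtain ⟨O, hO, hOo, hOlt⟩ := Set.exists_isOpen_lt_of_lt {t} ε (μ := μ)
    (h0 ▸ pos_iff_ne_zero.2 hε)
  obtain ⟨η, hη, hsub⟩ := Metric.nhds_basis_closedBall.mem_iff.1
    ((hU.inter hOo).mem_nhds ⟨ht, hO rfl⟩)
  rw [Real.closedBall_eq_Icc] at hsub
  refine ⟨η, hη, hsub.trans inter_subset_left, ?_⟩
  calc ∫⁻ x in Icc (t - η) (t + η), ρ x
      = μ (Icc (t - η) (t + η)) := by
        rw [hμ, withDensity_apply _ measurableSet_Icc, Measure.restrict_restrict measurableSet_Icc,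
          inter_eq_left.2 (hsub.trans inter_subset_left)]
    _ ≤ μ O := measure_mono (hsub.trans inter_subset_right)
    _ ≤ ε := hOlt.le

section

variable {c d p q : ℝ} {w g V : ℝ → ℝ}

theorem exists_zigzag_data
    (hwint : ∀ x ∈ Ioo c d, IntegrableOn (fun t => w t ^ p) (Ioo x d))
    (hV : ContinuousOn V (Ioo c d)) {U : Set ℝ} (hU : IsOpen U) (hUs : U ⊆ Ioo c d)
    {t : ℝ} (ht : t ∈ U) {a : ℝ} (haV : 1 < a * |V t|) {ε : ENNReal} (hε : ε ≠ 0) :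
    ∃ η > 0, Ioc (t - η) (t + η) ⊆ U ∧ c ≤ t - η ∧
      (∀ x ∈ Ioc (t - η) (t + η), 1 ≤ a * |V x|) ∧
      ∫⁻ x in Ioc (t - η) (t + η), ENNReal.ofReal (a ^ p * w x ^ p) ≤ ε := by
  obtain ⟨x₀, hx₀⟩ := exists_between (hUs ht).1
  have hx₀I : x₀ ∈ Ioo c d := ⟨hx₀.1, hx₀.2.trans (hUs ht).2⟩
  set O : Set ℝ := (U ∩ Ioi x₀) ∩ (Ioo c d ∩ (fun x => a * |V x|) ⁻¹' Ioi 1) with hO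
  have hOo : IsOpen O := (hU.inter isOpen_Ioi).inter
    ((continuousOn_const.mul hV.abs).isOpen_inter_preimage isOpen_Ioo isOpen_Ioi)
  have htO : t ∈ O := ⟨⟨ht, hx₀.2⟩, hUs ht, haV⟩
  have hOx : O ⊆ Ioo x₀ d := fun x hx => ⟨hx.1.2, hx.2.1.2⟩
  have hfin : ∫⁻ x in O, ENNReal.ofReal (a ^ p * w x ^ p) ≠ ⊤ := by
    have hi : IntegrableOn (fun x => a ^ p * w x ^ p) O :=
      ((hwint x₀ hx₀I).mono_set hOx).const_mul (a ^ p)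
    refine ne_top_of_le_ne_top hi.2.ne (lintegral_mono fun x => ?_)
    exact Real.ofReal_le_enorm _
  obtain ⟨η, hη, hsub, hle⟩ := exists_Icc_subset_setLIntegral_le hOo htO hfin hε
  have hsub' : Ioc (t - η) (t + η) ⊆ O := Ioc_subset_Icc_self.trans hsub
  refine ⟨η, hη, hsub'.trans fun x hx => hx.1.1, ?_, fun x hx => (hsub' hx).2.2.le,
    (lintegral_mono_set Ioc_subset_Icc_self).trans hle⟩
  have : t - η ∈ O := hsub (left_mem_Icc.2 (by linarith))
  exact this.2.1.1.le

theorem false_of_humps (hp : 0 < p) (hwm : Measurable w) (hwpos : ∀ x ∈ Ioo c d, 0 < w x)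
    (hwint : ∀ x ∈ Ioo c d, IntegrableOn (fun t => w t ^ p) (Ioo x d))
    (hi : ∀ f, memCh c d p w f → IntegrableOn (fun x => f x * g x) (Ioo c d))
    (hV : ContinuousOn V (Ioo c d)) (hgV : ∀ᵐ x ∂(volume.restrict (Ioo c d)), g x = V x)
    {U : ℕ → Set ℝ} (hUo : ∀ n, IsOpen (U n)) (hUs : ∀ n, U n ⊆ Ioo c d)
    (hUd : Pairwise (Function.onFun Disjoint U)) {t : ℕ → ℝ} (ht : ∀ n, t n ∈ U n)
    {a : ℕ → ℝ} (ha : ∀ n, 0 < a n) (haV : ∀ n, 1 < a n * |V (t n)|)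
    (hsum : ∀ x ∈ Ioo c d, Summable ({n | (U n ∩ Ioc c x).Nonempty}.indicator a)) : False := by
  choose η hη hJU hcη hJV hJw using fun n => exists_zigzag_data hwint hV (hUo n)
    (hUs n) (ht n) (haV n) (ε := (2⁻¹ : ENNReal) ^ n) (by simp)
  set J : ℕ → Set ℝ := fun n => Ioc (t n - η n) (t n + η n) with hJ
  set h : ℕ → ℝ := fun n => a n / (2 * η n) with hh
  have hh0 : ∀ n, 0 < h n := fun n => div_pos (ha n) (by linarith [hη n])
  have hha : ∀ n, h n * (2 * η n) = a n := fun n =>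
    div_mul_cancel₀ _ (by linarith [hη n] : (0 : ℝ) < 2 * η n).ne'
  have hJm : ∀ n, MeasurableSet (J n) := fun n => measurableSet_Ioc
  have hJd : Pairwise (Function.onFun Disjoint J) := fun m n hmn =>
    (hUd hmn).mono (hJU m) (hJU n)
  have hJI : ∀ n, J n ⊆ Ioo c d := fun n => (hJU n).trans (hUs n)
  set r : ℕ → ℝ → ℝ := fun n => zigzag (t n) (η n) (h n) with hr
  set f : ℝ → ℝ := fun x => ∑' n, r n x with hf
  have hrm : ∀ n, Measurable (r n) := fun n => measurable_zigzag
  have hfm : Measurable f := Measurable.tsum hrm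
  have hr0 : ∀ n x, x ∉ J n → r n x = 0 := fun n x hx => zigzag_of_notMem (hη n).le hx
  have hother : ∀ {m n : ℕ} {x : ℝ}, x ∈ J n → m ≠ n → x ∉ J m := fun hx hmn hxm =>
    disjoint_left.1 (hJd hmn) hxm hx
  have hfJ : ∀ n, ∀ x ∈ J n, f x = r n x := fun n x hx =>
    tsum_eq_single n fun m hmn => hr0 m x (hother hx hmn)
  have hle : ∀ x n, ∫ y in Ioc c x, ‖r n y‖ ≤ {n | (U n ∩ Ioc c x).Nonempty}.indicator a n := by
    intro x n
    by_cases hn : (U n ∩ Ioc c x).Nonempty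
    · rw [indicator_of_mem (show n ∈ {n | (U n ∩ Ioc c x).Nonempty} from hn)]
      exact (setIntegral_abs_zigzag_le (hη n).le (hh0 n).le _).trans (hha n).le
    · rw [indicator_of_notMem (show n ∉ {n | (U n ∩ Ioc c x).Nonempty} from hn)]
      refine (setIntegral_eq_zero_of_forall_eq_zero fun y hy => ?_).le
      rw [hr0 n y fun hyJ => hn ⟨y, hJU n hyJ, hy⟩, norm_zero]
  have hsumr : ∀ x ∈ Ioo c d, Summable fun n => ∫ y in Ioc c x, ‖r n y‖ := fun x hx =>
    Summable.of_nonneg_of_le (fun n => integral_nonneg fun y => norm_nonneg _) (hle x) (hsum x hx)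
  have hri : ∀ x n, Integrable (r n) (volume.restrict (Ioc c x)) := fun x n =>
    integrable_zigzag.restrict
  have hF : ∀ x ∈ Ioo c d, HasSum (fun n => ∫ y in Ioc c x, r n y) (∫ y in Ioc c x, f y) :=
    fun x hx => hasSum_integral_of_summable_integral_norm (hri x) (hsumr x hx)
  have hR0 : ∀ n x, x ∉ J n → ∫ y in Ioc c x, r n y = 0 := fun n x hx =>
    setIntegral_zigzag_eq_zero (hη n).le (hcη n) hx
  have hfi : ∀ x ∈ Ioo c d, IntegrableOn f (Ioc c x) := by
    intro x hx
    refine ⟨hfm.aestronglyMeasurable, ?_⟩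
    have h1 : ∀ y, ‖f y‖ₑ ≤ ∑' n, ‖r n y‖ₑ := by
      intro y
      by_cases hy : ∃ n, y ∈ J n
      · obtain ⟨n, hn⟩ := hy
        rw [hfJ n y hn]
        exact ENNReal.le_tsum n
      · have : f y = 0 := by
          simp only [hf, hr0 _ y (fun hn => hy ⟨_, hn⟩), tsum_zero]
        simp [this]
    have h2 : ∀ n, ∫⁻ y in Ioc c x, ‖r n y‖ₑ = ENNReal.ofReal (∫ y in Ioc c x, ‖r n y‖) :=
      fun n => (ofReal_integral_norm_eq_lintegral_enorm (hri x n)).symm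
    calc ∫⁻ y in Ioc c x, ‖f y‖ₑ ≤ ∫⁻ y in Ioc c x, ∑' n, ‖r n y‖ₑ := lintegral_mono h1
      _ = ∑' n, ∫⁻ y in Ioc c x, ‖r n y‖ₑ :=
        lintegral_tsum fun n => (hrm n).enorm.aemeasurable
      _ = ENNReal.ofReal (∑' n, ∫ y in Ioc c x, ‖r n y‖) := by
        rw [ENNReal.ofReal_tsum_of_nonneg (fun n => integral_nonneg fun y => norm_nonneg _)
          (hsumr x hx)]
        simp only [h2]
      _ < ⊤ := ENNReal.ofReal_lt_top
  have hmem : memCh c d p w f := by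
    refine ⟨hfm, hfi, ((hwm.mul (measurable_setIntegral_Ioc hfm c)).abs.pow_const
      p).aestronglyMeasurable, ?_⟩
    rw [hasFiniteIntegral_iff_ofReal (ae_of_all _ fun x => by positivity)]
    have hpt : ∀ x ∈ Ioo c d, ENNReal.ofReal (|w x * ∫ y in Ioc c x, f y| ^ p) ≤
        ∑' n, (J n).indicator (fun x => ENNReal.ofReal (a n ^ p * w x ^ p)) x := by
      intro x hx
      by_cases hxJ : ∃ n, x ∈ J n
      · obtain ⟨n, hn⟩ := hxJ
        have hFx : ∫ y in Ioc c x, f y = ∫ y in Ioc c x, r n y :=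
          (hF x hx).unique (hasSum_single n fun m hmn => hR0 m x (hother hn hmn))
        refine le_trans ?_ (ENNReal.le_tsum n)
        rw [indicator_of_mem hn, hFx, abs_mul, mul_comm, abs_of_pos (hwpos x hx),
          Real.mul_rpow (abs_nonneg _) (hwpos x hx).le]
        have := Real.rpow_nonneg (hwpos x hx).le p
        have hab : |∫ y in Ioc c x, r n y| ≤ a n :=
          (abs_setIntegral_zigzag_le (hη n).le (hh0 n).le _).trans (hha n).le
        gcongr
      · have hFx : ∫ y in Ioc c x, f y = 0 :=
          (hF x hx).unique (by
            simp only [hR0 _ x (fun hn => hxJ ⟨_, hn⟩)]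
            exact hasSum_zero)
        simp [hFx, hp.ne']
    calc ∫⁻ x in Ioo c d, ENNReal.ofReal (|w x * ∫ y in Ioc c x, f y| ^ p)
        ≤ ∫⁻ x in Ioo c d, ∑' n, (J n).indicator
            (fun x => ENNReal.ofReal (a n ^ p * w x ^ p)) x :=
          setLIntegral_mono' measurableSet_Ioo hpt
      _ = ∑' n, ∫⁻ x in Ioo c d, (J n).indicator
            (fun x => ENNReal.ofReal (a n ^ p * w x ^ p)) x :=
          lintegral_tsum fun n => (Measurable.indicator
            ((hwm.pow_const p).const_mul _).ennreal_ofReal (hJm n)).aemeasurable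
      _ ≤ ∑' n, (2⁻¹ : ENNReal) ^ n := by
          refine ENNReal.tsum_le_tsum fun n => ?_
          rw [lintegral_indicator (hJm n), Measure.restrict_restrict (hJm n),
            inter_eq_left.2 (hJI n)]
          exact hJw n
      _ < ⊤ := by
          rw [ENNReal.tsum_geometric, ENNReal.inv_lt_top]
          simp
  have hfg := (hi f hmem).2
  rw [HasFiniteIntegral] at hfg
  refine hfg.not_ge ?_
  have hone : ∀ n, 1 ≤ ∫⁻ x in J n, ‖f x * g x‖ₑ := by
    intro n
    have hη2 : 0 < 2 * η n := by linarith [hη n]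
    have hpt : ∀ᵐ x ∂(volume.restrict (J n)),
        ENNReal.ofReal (1 / (2 * η n)) ≤ ‖f x * g x‖ₑ := by
      filter_upwards [ae_restrict_mem (hJm n),
        ae_restrict_of_ae_restrict_of_subset (hJI n) hgV] with x hx hgx
      rw [Real.enorm_eq_ofReal_abs, abs_mul, hfJ n x hx, hgx, hr, abs_zigzag_of_mem hx,
        abs_of_pos (hh0 n), hh]
      refine ENNReal.ofReal_le_ofReal ?_
      rw [div_mul_eq_mul_div]
      exact div_le_div_of_nonneg_right (hJV n x hx) hη2.le
    calc (1 : ENNReal) = ∫⁻ x in J n, ENNReal.ofReal (1 / (2 * η n)) := by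
          rw [setLIntegral_const, hJ, Real.volume_Ioc,
            show t n + η n - (t n - η n) = 2 * η n by ring, ← ENNReal.ofReal_mul (by positivity),
            one_div, inv_mul_cancel₀ hη2.ne', ENNReal.ofReal_one]
      _ ≤ _ := lintegral_mono_ae hpt
  calc (⊤ : ENNReal) = ∑' _ : ℕ, 1 := (ENNReal.tsum_const_eq_top_of_ne_zero one_ne_zero).symm
    _ ≤ ∑' n, ∫⁻ x in J n, ‖f x * g x‖ₑ := ENNReal.tsum_le_tsum hone
    _ = ∫⁻ x in ⋃ n, J n, ‖f x * g x‖ₑ := (lintegral_iUnion hJm hJd _).symm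
    _ ≤ ∫⁻ x in Ioo c d, ‖f x * g x‖ₑ := lintegral_mono_set (iUnion_subset hJI)

end

section

variable {c d p q : ℝ} {w g V : ℝ → ℝ}

theorem exists_strictMono_mem_Ioo_of_forall_exists {φ : ℝ → ℝ} (hφ : ContinuousOn φ (Ioo c d))
    (hinj : InjOn φ (Ioo c d)) (hV : ContinuousOn V (Ioo c d)) {θ : ℕ → ℝ}
    (hbig : ∀ n N : ℕ, ∃ x ∈ Ioo c d, (N : ℝ) < φ x ∧ θ n < |V x|) :
    ∃ k : ℕ → ℕ, StrictMono k ∧ ∃ t : ℕ → ℝ, ∀ n,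
      t n ∈ Ioo c d ∧ φ (t n) ∈ Ioo (k n : ℝ) (k n + 1) ∧ θ n < |V (t n)| := by
  have key : ∀ n, ∃ᶠ k : ℕ in atTop, ∃ t,
      t ∈ Ioo c d ∧ φ t ∈ Ioo (k : ℝ) (k + 1) ∧ θ n < |V t| := by
    intro n
    rw [frequently_atTop]
    intro N
    obtain ⟨x, hx, hNx, hθx⟩ := hbig n N
    set O : Set ℝ := (Ioo c d ∩ φ ⁻¹' Ioi (N : ℝ)) ∩ (Ioo c d ∩ (fun x => |V x|) ⁻¹' Ioi (θ n))
    have hO : IsOpen O := (hφ.isOpen_inter_preimage isOpen_Ioo isOpen_Ioi).inter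
      (hV.abs.isOpen_inter_preimage isOpen_Ioo isOpen_Ioi)
    have hcount : (Ioo c d ∩ φ ⁻¹' range ((↑) : ℕ → ℝ)).Countable :=
      MapsTo.countable_of_injOn (t := range ((↑) : ℕ → ℝ)) (fun y hy => hy.2)
        (hinj.mono inter_subset_left) (countable_range _)
    obtain ⟨y, hy, hyn⟩ : ∃ y ∈ O, y ∉ Ioo c d ∩ φ ⁻¹' range ((↑) : ℕ → ℝ) := by
      by_contra! hcon
      exact (hO.measure_pos volume ⟨x, ⟨hx, hNx⟩, hx, hθx⟩).ne'
        (measure_mono_null hcon (hcount.measure_zero volume))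
    have hyN : (N : ℝ) < φ y := hy.1.2
    have hy0 : 0 ≤ φ y := (Nat.cast_nonneg N).trans hyN.le
    refine ⟨⌊φ y⌋₊, Nat.le_floor hyN.le, y, hy.1.1, ⟨lt_of_le_of_ne (Nat.floor_le hy0) ?_,
      Nat.lt_floor_add_one _⟩, hy.2.2⟩
    exact fun h => hyn ⟨hy.1.1, _, h⟩
  obtain ⟨k, hk, h⟩ := extraction_forall_of_frequently key
  choose t ht using h
  exact ⟨k, hk, t, ht⟩

theorem isOpen_levelBand {φ : ℝ → ℝ} (hφ : ContinuousOn φ (Ioo c d)) (r s : ℝ) :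
    IsOpen {x | x ∈ Ioo c d ∧ φ x ∈ Ioo r s} :=
  hφ.isOpen_inter_preimage isOpen_Ioo isOpen_Ioo

theorem pairwise_disjoint_levelBand (φ : ℝ → ℝ) {k : ℕ → ℕ} (hk : StrictMono k) :
    Pairwise (Function.onFun Disjoint
      fun n => {x | x ∈ Ioo c d ∧ φ x ∈ Ioo (k n : ℝ) (k n + 1)}) := by
  intro m n hmn
  refine disjoint_left.2 fun x hm hn => hmn (hk.injective ?_)
  have h1 : (k m : ℝ) < (k n + 1 : ℕ) := by push_cast; exact hm.2.1.trans hn.2.2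
  have h2 : (k n : ℝ) < (k m + 1 : ℕ) := by push_cast; exact hn.2.1.trans hm.2.2
  have h3 := Nat.cast_lt.1 h1
  have h4 := Nat.cast_lt.1 h2
  omega

theorem exists_forall_gt_eq_zero (hp : 0 < p) (hwm : Measurable w)
    (hwpos : ∀ x ∈ Ioo c d, 0 < w x)
    (hwint : ∀ x ∈ Ioo c d, IntegrableOn (fun t => w t ^ p) (Ioo x d))
    (hi : ∀ f, memCh c d p w f → IntegrableOn (fun x => f x * g x) (Ioo c d))
    (hV : ContinuousOn V (Ioo c d)) (hgV : ∀ᵐ x ∂(volume.restrict (Ioo c d)), g x = V x) :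
    ∃ N : ℕ, ∀ x ∈ Ioo c d, (N : ℝ) < 1 / (d - x) → V x = 0 := by
  by_contra! hcon
  have hpos : ∀ x ∈ Ioo c d, 0 < d - x := fun x hx => sub_pos.2 hx.2
  have hφ : ContinuousOn (fun x : ℝ => 1 / (d - x)) (Ioo c d) :=
    continuousOn_const.div (continuousOn_const.sub continuousOn_id) fun x hx => (hpos x hx).ne'
  have hinj : InjOn (fun x : ℝ => 1 / (d - x)) (Ioo c d) := by
    intro x _ y _ hxy
    simpa using hxy
  obtain ⟨k, hk, t, ht⟩ := exists_strictMono_mem_Ioo_of_forall_exists (θ := fun _ => 0) hφ hinj hV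
    fun _ N => by
      obtain ⟨x, hx, hN, h0⟩ := hcon N
      exact ⟨x, hx, hN, abs_pos.2 h0⟩
  refine false_of_humps hp hwm hwpos hwint hi hV hgV (fun n => isOpen_levelBand hφ (k n) (k n + 1))
    (fun n x hx => hx.1) (pairwise_disjoint_levelBand _ hk) (t := t)
    (fun n => ⟨(ht n).1, (ht n).2.1⟩) (a := fun n => 2 / |V (t n)|)
    (fun n => div_pos two_pos (ht n).2.2) (fun n => ?_) fun x hx => ?_
  · rw [div_mul_cancel₀ _ (ht n).2.2.ne']
    norm_num
  · refine summable_of_hasFiniteSupport (((finite_lt_nat ⌈1 / (d - x)⌉₊).subset ?_))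
    refine support_indicator_subset.trans ?_
    rintro n ⟨y, hy, hyx⟩
    have h1 : (n : ℝ) ≤ k n := Nat.cast_le.2 (hk.id_le n)
    have h2 : 1 / (d - y) ≤ 1 / (d - x) :=
      one_div_le_one_div_of_le (hpos x hx) (by linarith [hyx.2])
    exact Nat.lt_ceil.2 (h1.trans_lt (hy.2.1.trans_le h2))

theorem exists_forall_gt_abs_le (hp : 0 < p) (hwm : Measurable w)
    (hwpos : ∀ x ∈ Ioo c d, 0 < w x)
    (hwint : ∀ x ∈ Ioo c d, IntegrableOn (fun t => w t ^ p) (Ioo x d))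
    (hi : ∀ f, memCh c d p w f → IntegrableOn (fun x => f x * g x) (Ioo c d))
    (hV : ContinuousOn V (Ioo c d)) (hgV : ∀ᵐ x ∂(volume.restrict (Ioo c d)), g x = V x) :
    ∃ n N : ℕ, ∀ x ∈ Ioo c d, (N : ℝ) < 1 / (x - c) → |V x| ≤ 2 ^ n := by
  by_contra! hcon
  have hφ : ContinuousOn (fun x : ℝ => 1 / (x - c)) (Ioo c d) :=
    continuousOn_const.div (continuousOn_id.sub continuousOn_const)
      fun x hx => (sub_pos.2 hx.1).ne'
  have hinj : InjOn (fun x : ℝ => 1 / (x - c)) (Ioo c d) := by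
    intro x _ y _ hxy
    simpa using hxy
  obtain ⟨k, hk, t, ht⟩ := exists_strictMono_mem_Ioo_of_forall_exists (θ := fun n => 2 ^ n)
    hφ hinj hV hcon
  refine false_of_humps hp hwm hwpos hwint hi hV hgV (fun n => isOpen_levelBand hφ (k n) (k n + 1))
    (fun n x hx => hx.1) (pairwise_disjoint_levelBand _ hk) (t := t)
    (fun n => ⟨(ht n).1, (ht n).2.1⟩) (a := fun n => (1 / 2) ^ n)
    (fun n => by positivity) (fun n => ?_) fun x hx => summable_geometric_two.indicator _
  calc (1 : ℝ) = (1 / 2) ^ n * 2 ^ n := by rw [← mul_pow]; norm_num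
    _ < (1 / 2) ^ n * |V (t n)| := mul_lt_mul_of_pos_left (ht n).2.2 (by positivity)

theorem exists_eq_zero_and_bounded (hcd : c < d) (hp : 0 < p) (hwm : Measurable w)
    (hwpos : ∀ x ∈ Ioo c d, 0 < w x)
    (hwint : ∀ x ∈ Ioo c d, IntegrableOn (fun t => w t ^ p) (Ioo x d))
    (hi : ∀ f, memCh c d p w f → IntegrableOn (fun x => f x * g x) (Ioo c d))
    (hV : ContinuousOn V (Ioo c d)) (hgV : ∀ᵐ x ∂(volume.restrict (Ioo c d)), g x = V x) :
    (∃ b ∈ Ioo c d, ∀ x ∈ Ioo b d, V x = 0) ∧ ∃ M, ∀ x ∈ Ioo c d, |V x| ≤ M := by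
  obtain ⟨N, hN⟩ := exists_forall_gt_eq_zero hp hwm hwpos hwint hi hV hgV
  obtain ⟨n, K, hK⟩ := exists_forall_gt_abs_le hp hwm hwpos hwint hi hV hgV
  have hb : ∃ b ∈ Ioo c d, ∀ x ∈ Ioo b d, V x = 0 := by
    obtain ⟨b, hb1, hb2⟩ := exists_between
      (max_lt hcd (sub_lt_self d (by positivity : (0 : ℝ) < 1 / (N + 1))))
    rw [max_lt_iff] at hb1
    refine ⟨b, ⟨hb1.1, hb2⟩, fun x hx => hN x ⟨hb1.1.trans hx.1, hx.2⟩ ?_⟩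
    have h1 : d - x < 1 / (N + 1) := by linarith [hb1.2, hx.1]
    rw [lt_div_iff₀ (by positivity)] at h1
    rw [lt_div_iff₀ (sub_pos.2 hx.2)]
    nlinarith [sub_pos.2 hx.2]
  obtain ⟨b, hbI, hb⟩ := hb
  refine ⟨⟨b, hbI, hb⟩, ?_⟩
  obtain ⟨e, he1, he2⟩ := exists_between
      (lt_min hcd (lt_add_of_pos_right c (by positivity : (0 : ℝ) < 1 / (K + 1))))
  rw [lt_min_iff] at he2
  obtain ⟨M, hM⟩ := isCompact_Icc.exists_bound_of_continuousOn
    (hV.mono (Icc_subset_Ioo he1 hbI.2 : Icc e b ⊆ Ioo c d))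
  refine ⟨max (2 ^ n) M, fun x hx => ?_⟩
  rcases lt_or_ge x e with hxe | hxe
  · refine (hK x hx ?_).trans (le_max_left _ _)
    have h1 : x - c < 1 / (K + 1) := by linarith [he2.2]
    rw [lt_div_iff₀ (by positivity)] at h1
    rw [lt_div_iff₀ (sub_pos.2 hx.1)]
    nlinarith [sub_pos.2 hx.1]
  · rcases lt_or_ge b x with hbx | hbx
    · rw [hb x ⟨hbx, hx.2⟩, abs_zero]
      exact (by positivity : (0 : ℝ) ≤ 2 ^ n).trans (le_max_left _ _)
    · exact (hM x ⟨hxe, hbx⟩).trans (le_max_right _ _)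

theorem setIntegral_Ioo_sub_setIntegral_Ioo {v : ℝ → ℝ}
    (hv : ∀ x ∈ Ioo c d, IntegrableOn v (Ioo x d)) {x y : ℝ} (hx : x ∈ Ioo c d)
    (hy : y ∈ Ioo c d) :
    IntegrableOn v (uIcc x y) ∧
      (∫ t in Ioo x d, v t) - ∫ t in Ioo y d, v t = ∫ t in x..y, v t := by
  have hsplit : ∀ {x y : ℝ}, x ∈ Ioo c d → y ∈ Ioo c d →
      x ≤ y → (∫ t in Ioo x d, v t) - ∫ t in Ioo y d, v t = ∫ t in x..y, v t := by
    intro x y hx hy hxy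
    rw [← Ioc_union_Ioo_eq_Ioo hxy hy.2, setIntegral_union
      (disjoint_left.2 fun t h1 h2 => h1.2.not_gt h2.1) measurableSet_Ioo
      ((hv x hx).mono_set fun t ht => ⟨ht.1, ht.2.trans_lt hy.2⟩) (hv y hy),
      intervalIntegral.integral_of_le hxy]
    ring
  refine ⟨?_, ?_⟩
  · obtain ⟨z, hz1, hz2⟩ := exists_between (lt_min hx.1 hy.1)
    have hmin : min x y < d := (min_le_left _ _).trans_lt hx.2
    exact (hv z ⟨hz1, hz2.trans hmin⟩).mono_set (Icc_subset_Ioo hz2 (max_lt hx.2 hy.2))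
  · rcases le_total x y with hxy | hxy
    · exact hsplit hx hy hxy
    · rw [intervalIntegral.integral_symm, ← hsplit hy hx hxy]
      ring

theorem continuousOn_of_sub_eq_intervalIntegral {v G : ℝ → ℝ}
    (hG : ∀ x ∈ Ioo c d, ∀ y ∈ Ioo c d,
      IntegrableOn v (uIcc x y) ∧ G y - G x = ∫ t in x..y, v t) : ContinuousOn G (Ioo c d) := by
  intro x hx
  obtain ⟨a, ha1, ha2⟩ := exists_between hx.1
  obtain ⟨b, hb1, hb2⟩ := exists_between hx.2
  have ha : a ∈ Ioo c d := ⟨ha1, ha2.trans hx.2⟩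
  have hb : b ∈ Ioo c d := ⟨hx.1.trans hb1, hb2⟩
  have hab : a ≤ b := (ha2.trans hb1).le
  have h1 : ContinuousOn (fun y => G a + ∫ t in a..y, v t) (uIcc a b) :=
    continuousOn_const.add (intervalIntegral.continuousOn_primitive_interval (hG a ha b hb).1)
  rw [uIcc_of_le hab] at h1
  have h2 : ContinuousOn G (Icc a b) := by
    refine h1.congr fun y hy => ?_
    have h3 := (hG a ha y ⟨ha1.trans_le hy.1, hy.2.trans_lt hb2⟩).2
    simp only [← h3, add_sub_cancel]
  exact (h2.continuousAt (Icc_mem_nhds ha2 hb1)).continuousWithinAt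

theorem eqOn_Ioo_of_ae_eq {G H : ℝ → ℝ} (hG : ContinuousOn G (Ioo c d))
    (hH : ContinuousOn H (Ioo c d)) (h : ∀ᵐ x ∂(volume.restrict (Ioo c d)), G x = H x) :
    EqOn G H (Ioo c d) :=
  Measure.eqOn_of_ae_eq h hG hH (by rw [isOpen_Ioo.interior_eq]; exact subset_closure)

theorem ae_eq_of_intervalIntegral_eq (hcd : c < d) {v v' : ℝ → ℝ}
    (hv : ∀ x ∈ Ioo c d, IntegrableOn v (Ioo x d))
    (hv' : ∀ x ∈ Ioo c d, IntegrableOn v' (Ioo x d))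
    (h : ∀ x ∈ Ioo c d, ∀ y ∈ Ioo c d, ∫ t in x..y, v t = ∫ t in x..y, v' t) :
    ∀ᵐ x ∂(volume.restrict (Ioo c d)), v x = v' x := by
  refine ae_restrict_Ioo_of_forall_Ioo hcd fun x hx => ?_
  have hint : IntervalIntegrable (fun t => v t - v' t) volume x d := by
    rw [intervalIntegrable_iff_integrableOn_Ioo_of_le hx.2.le]
    exact (hv x hx).sub (hv' x hx)
  rw [ae_restrict_iff' measurableSet_Ioo]
  filter_upwards [hint.ae_hasDerivAt_integral] with y hy hyI
  rw [uIcc_of_le hx.2.le] at hy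
  have h1 := hy (Ioo_subset_Icc_self hyI) x (left_mem_Icc.2 hx.2.le)
  have h2 : (fun z => ∫ t in x..z, (v t - v' t)) =ᶠ[nhds y] fun _ => 0 := by
    filter_upwards [isOpen_Ioo.mem_nhds hyI] with z hz
    have hzI : z ∈ Ioo c d := ⟨hx.1.trans hz.1, hz.2⟩
    rw [intervalIntegral.integral_sub, h x hx z hzI, sub_self]
    · exact ((setIntegral_Ioo_sub_setIntegral_Ioo hv hx hzI).1).intervalIntegrable
    · exact ((setIntegral_Ioo_sub_setIntegral_Ioo hv' hx hzI).1).intervalIntegrable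
  exact sub_eq_zero.1 (h1.unique ((hasDerivAt_const y (0 : ℝ)).congr_of_eventuallyEq h2))

theorem exists_goodRepCh_of_bounded (hcd : c < d) (hpq : p.HolderConjugate q)
    (hwm : Measurable w) (hwpos : ∀ x ∈ Ioo c d, 0 < w x)
    (hwint : ∀ x ∈ Ioo c d, IntegrableOn (fun t => w t ^ p) (Ioo x d))
    {C : ℝ} (hC : 0 ≤ C)
    (hi : ∀ f, memCh c d p w f → IntegrableOn (fun x => f x * g x) (Ioo c d))
    (hb : ∀ f, memCh c d p w f → |∫ x in Ioo c d, f x * g x| ≤ C * chNorm c d p w f) :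
    ∃ (gt v : ℝ → ℝ) (b : ℝ), goodRepCh c d q w g gt v b := by
  obtain ⟨v, hvm, hvq, -, hvi, hgv⟩ := exists_density_of_bounded hcd hpq hwm hwpos hwint hC hi hb
  have hV : ∀ x ∈ Ioo c d, ∀ y ∈ Ioo c d, IntegrableOn v (uIcc x y) ∧
      (-∫ t in Ioo y d, v t) - (-∫ t in Ioo x d, v t) = ∫ t in x..y, v t := fun x hx y hy => by
    obtain ⟨h1, h2⟩ := setIntegral_Ioo_sub_setIntegral_Ioo hvi hx hy
    exact ⟨h1, by rw [← h2]; ring⟩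
  obtain ⟨⟨b, hbI, hb0⟩, hM⟩ := exists_eq_zero_and_bounded hcd hpq.pos hwm hwpos hwint hi
    (continuousOn_of_sub_eq_intervalIntegral (G := fun x => -∫ t in Ioo x d, v t) hV) hgv
  refine ⟨_, v, b, hbI, hvm, hgv, hV, hM, hvi, fun x hx => ?_, hvq⟩
  rcases lt_or_ge b x with hbx | hxb
  · rw [indicator_of_notMem fun h => absurd h.2 hbx.not_ge, neg_zero]
    exact hb0 x ⟨hbx, hx.2⟩
  · rw [indicator_of_mem (show x ∈ Ioc c b from ⟨hx.1, hxb⟩)]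

theorem goodRepCh_rpow_integral_le_of_bounded (hcd : c < d) (hpq : p.HolderConjugate q)
    (hwm : Measurable w) (hwpos : ∀ x ∈ Ioo c d, 0 < w x)
    (hwint : ∀ x ∈ Ioo c d, IntegrableOn (fun t => w t ^ p) (Ioo x d))
    {C : ℝ} (hC : 0 ≤ C)
    (hi : ∀ f, memCh c d p w f → IntegrableOn (fun x => f x * g x) (Ioo c d))
    (hb : ∀ f, memCh c d p w f → |∫ x in Ioo c d, f x * g x| ≤ C * chNorm c d p w f)
    {gt v : ℝ → ℝ} {b : ℝ} (hG : goodRepCh c d q w g gt v b) :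
    (∫ x in Ioo c d, |v x / w x| ^ q) ^ (1 / q) ≤ C := by
  obtain ⟨-, -, hggt, hgt, -, hvi, -, -⟩ := hG
  obtain ⟨v', -, -, hv'C, hv'i, hgv'⟩ :=
    exists_density_of_bounded hcd hpq hwm hwpos hwint hC hi hb
  have hV : ∀ x ∈ Ioo c d, ∀ y ∈ Ioo c d, IntegrableOn v' (uIcc x y) ∧
      (-∫ t in Ioo y d, v' t) - (-∫ t in Ioo x d, v' t) = ∫ t in x..y, v' t :=
    fun x hx y hy => by
    obtain ⟨h1, h2⟩ := setIntegral_Ioo_sub_setIntegral_Ioo hv'i hx hy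
    exact ⟨h1, by rw [← h2]; ring⟩
  have heq : EqOn gt (fun x => -∫ t in Ioo x d, v' t) (Ioo c d) :=
    eqOn_Ioo_of_ae_eq (continuousOn_of_sub_eq_intervalIntegral hgt)
      (continuousOn_of_sub_eq_intervalIntegral hV) (by
        filter_upwards [hggt, hgv'] with x h1 h2
        rw [← h1, h2])
  have hvv' := ae_eq_of_intervalIntegral_eq hcd hvi hv'i fun x hx y hy => by
    rw [← (hgt x hx y hy).2, ← (hV x hx y hy).2, heq hx, heq hy]
  refine le_trans (le_of_eq ?_) hv'C
  congr 1
  refine integral_congr_ae ?_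
  filter_upwards [hvv'] with x hx
  rw [hx]

theorem chNorm_nonneg (c d p : ℝ) (w f : ℝ → ℝ) : 0 ≤ chNorm c d p w f :=
  Real.rpow_nonneg (integral_nonneg fun _ => Real.rpow_nonneg (abs_nonneg _) _) _

end

theorem stmt10 (c d p q : ℝ) (hcd : c < d) (hp : 1 < p) (hq : q = p / (p - 1))
    (w : ℝ → ℝ) (hwm : Measurable w)
    (hwpos : ∀ x ∈ Ioo c d, 0 < w x)
    (hwint : ∀ x ∈ Ioo c d, IntegrableOn (fun t => w t ^ p) (Ioo x d))
    (g : ℝ → ℝ) (hgm : Measurable g) :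
    ((∃ C : ℝ, 0 ≤ C ∧ ∀ f : ℝ → ℝ, memCh c d p w f →
        IntegrableOn (fun x => f x * g x) (Ioo c d) ∧
        |∫ x in Ioo c d, f x * g x| ≤ C * chNorm c d p w f) ↔
      ∃ (gt v : ℝ → ℝ) (b : ℝ), goodRepCh c d q w g gt v b)
    ∧
    (∀ (gt v : ℝ → ℝ) (b : ℝ), goodRepCh c d q w g gt v b →
      (⨆ f : ℝ → ℝ, ⨆ _ : memCh c d p w f ∧
          IntegrableOn (fun x => f x * g x) (Ioo c d) ∧ chNorm c d p w f ≠ 0,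
        ENNReal.ofReal (|∫ x in Ioo c d, f x * g x| / chNorm c d p w f))
      = ENNReal.ofReal ((∫ x in Ioo c d, |v x / w x| ^ q) ^ (1/q))) := by
  have hpq : p.HolderConjugate q := hq ▸ Real.HolderConjugate.conjExponent hp
  have hnorm : ∀ v : ℝ → ℝ, 0 ≤ (∫ x in Ioo c d, |v x / w x| ^ q) ^ (1 / q) := fun v =>
    Real.rpow_nonneg (integral_nonneg fun _ => Real.rpow_nonneg (abs_nonneg _) _) _
  refine ⟨⟨?_, ?_⟩, ?_⟩
  · rintro ⟨C, hC, h⟩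
    exact exists_goodRepCh_of_bounded hcd hpq hwm hwpos hwint hC (fun f hf => (h f hf).1)
      fun f hf => (h f hf).2
  · rintro ⟨gt, v, b, hG⟩
    exact ⟨_, hnorm v, fun f hf => ⟨integrableOn_mul_of_goodRepCh hgm hG hf,
      abs_integral_mul_le_of_goodRepCh hpq hwm hwpos hgm hG hf⟩⟩
  · intro gt v b hG
    have hi : ∀ f, memCh c d p w f → IntegrableOn (fun x => f x * g x) (Ioo c d) :=
      fun f hf => integrableOn_mul_of_goodRepCh hgm hG hf
    have hb : ∀ f, memCh c d p w f → |∫ x in Ioo c d, f x * g x| ≤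
        (∫ x in Ioo c d, |v x / w x| ^ q) ^ (1 / q) * chNorm c d p w f :=
      fun f hf => abs_integral_mul_le_of_goodRepCh hpq hwm hwpos hgm hG hf
    have hpos : ∀ f, chNorm c d p w f ≠ 0 → 0 < chNorm c d p w f :=
      fun f hf => (chNorm_nonneg c d p w f).lt_of_ne' hf
    set S := ⨆ f : ℝ → ℝ, ⨆ _ : memCh c d p w f ∧
      IntegrableOn (fun x => f x * g x) (Ioo c d) ∧ chNorm c d p w f ≠ 0,
      ENNReal.ofReal (|∫ x in Ioo c d, f x * g x| / chNorm c d p w f) with hS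
    have hle : S ≤ ENNReal.ofReal ((∫ x in Ioo c d, |v x / w x| ^ q) ^ (1 / q)) :=
      iSup₂_le fun f hf => ENNReal.ofReal_le_ofReal
        ((div_le_iff₀ (hpos f hf.2.2)).2 (hb f hf.1))
    have hStop : S ≠ ⊤ := ne_top_of_le_ne_top ENNReal.ofReal_ne_top hle
    refine le_antisymm hle (ENNReal.ofReal_le_of_le_toReal ?_)
    refine goodRepCh_rpow_integral_le_of_bounded hcd hpq hwm hwpos hwint ENNReal.toReal_nonneg hi
      (fun f hf => ?_) hG
    by_cases h0 : chNorm c d p w f = 0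
    · simpa [h0] using hb f hf
    · rw [← div_le_iff₀ (hpos f h0)]
      refine (ENNReal.ofReal_le_iff_le_toReal hStop).1 ?_
      exact le_iSup₂_of_le (f := fun f _ =>
        ENNReal.ofReal (|∫ x in Ioo c d, f x * g x| / chNorm c d p w f)) f ⟨hf, hi f hf, h0⟩ le_rfl
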